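/- arXiv:1508.06720 — 4 statements merged into one kernel-verified Lean document; each statement's English description precedes it below -/
import Mathlib

section
/- A rational, closed, proper polyhedral cone has only finitely many fundamental integer solutions (in particular, their norms are bounded). Precisely: let A be an m × n integer matrix and let C = {x ∈ ℝⁿ | (A x)ᵢ ≥ 0 for every i = 1, …, m}. Assume C is proper, i.e., C ∩ (−C) = {0}. Call a vector v ∈ ℤⁿ a solution if its image in ℝⁿ lies in C, and call a nonzero solution v fundamental if it cannot be written as v = v₁ + v₂ with v₁, v₂ nonzero solutions. Then the set of fundamental solutions is finite. -/
/-- The rational polyhedral cone `{x ∈ ℝⁿ | A x ≥ 0}` associated to an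
integer matrix `A`. -/
def integerCone {m n : ℕ} (A : Matrix (Fin m) (Fin n) ℤ) : Set (Fin n → ℝ) :=
  {x | ∀ i, 0 ≤ (A.map ((↑) : ℤ → ℝ)).mulVec x i}

/-- An integer vector is a solution if its real cast lies in the cone. -/
def IsConeSolution {m n : ℕ} (A : Matrix (Fin m) (Fin n) ℤ) (v : Fin n → ℤ) : Prop :=
  (fun i => (v i : ℝ)) ∈ integerCone A

/-- A nonzero solution is fundamental if it is not the sum of two nonzero
solutions. -/
def IsFundamentalSolution {m n : ℕ} (A : Matrix (Fin m) (Fin n) ℤ) (v : Fin n → ℤ) : Prop :=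
  IsConeSolution A v ∧ v ≠ 0 ∧
    ¬∃ v₁ v₂ : Fin n → ℤ, v₁ ≠ 0 ∧ v₂ ≠ 0 ∧
      IsConeSolution A v₁ ∧ IsConeSolution A v₂ ∧ v = v₁ + v₂

lemma isConeSolution_iff_int {m n : ℕ} (A : Matrix (Fin m) (Fin n) ℤ) (v : Fin n → ℤ) :
    IsConeSolution A v ↔ ∀ i, 0 ≤ A.mulVec v i := by
  unfold IsConeSolution integerCone
  simp only [Set.mem_setOf_eq]
  refine forall_congr' fun i => ?_
  have : (A.map ((↑) : ℤ → ℝ)).mulVec (fun i => (v i : ℝ)) i = ((A.mulVec v i : ℤ) : ℝ) := by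
    simp [Matrix.mulVec, dotProduct]
  rw [this]
  exact_mod_cast Iff.rfl

/-- A rational, closed, proper polyhedral cone has only finitely many
fundamental integer solutions. -/
theorem finite_fundamental_solutions {m n : ℕ} (A : Matrix (Fin m) (Fin n) ℤ)
    (hproper : integerCone A ∩ (-(integerCone A)) = {0}) :
    {v : Fin n → ℤ | IsFundamentalSolution A v}.Finite := by
  by_contra hinf
  let e := Set.Infinite.natEmbedding _ hinf
  have hw : WellQuasiOrderedLE (Fin m → ℕ) := inferInstance
  obtain ⟨a, b, hab, hle⟩ := hw.wqo (fun k i => (A.mulVec (e k).1 i).toNat)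
  have hne : (e a).1 ≠ (e b).1 := fun h => hab.ne (e.injective (Subtype.ext h))
  obtain ⟨ha, ha0, -⟩ := (e a).2
  obtain ⟨hb, -, hb2⟩ := (e b).2
  refine hb2 ⟨(e a).1, (e b).1 - (e a).1, ha0, sub_ne_zero.2 hne.symm, ha, ?_, by abel⟩
  rw [isConeSolution_iff_int] at ha hb ⊢
  intro i
  have h1 := ha i
  have h2 := hb i
  have h3 := hle i
  simp only [Matrix.mulVec_sub, Pi.sub_apply] at h3 ⊢
  omega
end

section
/- The Newton–Kantorovich criterion eventually holds near a non-degenerate zero. Precisely: let U ⊆ ℝⁿ be open, let F : U → ℝⁿ be C²-smooth on U, let x∞ ∈ U satisfy F(x∞) = 0, and suppose the Fréchet derivative DF(x∞) is a continuous linear equivalence (non-singular Jacobian at x∞). Then there exists δ > 0 such that for every x₀ with ‖x₀ − x∞‖ < δ there exists ε > 0 such that: the open ball B(x₀, ε) is contained in U and contains x∞; the derivative DF(x) is a continuous linear equivalence for every x ∈ B(x₀, ε); and ‖DF(x)⁻¹ (F(x₀))‖ < ε for all x ∈ B(x₀, ε). -/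
/-- The Newton-Kantorovich criterion eventually holds near a non-degenerate
zero: if `F` is `C²` on an open set `U`, vanishes at `xinf ∈ U`, and its
Fréchet derivative at `xinf` is a continuous linear equivalence, then all
`x₀` close enough to `xinf` admit a radius `ε > 0` such that the ball
`B(x₀, ε)` lies in `U`, contains `xinf`, the derivative is a continuous
linear equivalence throughout the ball, and `‖DF(x)⁻¹ F(x₀)‖ < ε` on the
ball. -/
theorem newton_kantorovich_criterion_eventually_holds (n : ℕ)
    (U : Set (EuclideanSpace ℝ (Fin n))) (hU : IsOpen U)
    (F : EuclideanSpace ℝ (Fin n) → EuclideanSpace ℝ (Fin n))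
    (hF : ContDiffOn ℝ 2 F U)
    (xinf : EuclideanSpace ℝ (Fin n)) (hmem : xinf ∈ U) (hzero : F xinf = 0)
    (hJ : ∃ J : EuclideanSpace ℝ (Fin n) ≃L[ℝ] EuclideanSpace ℝ (Fin n),
      (J : EuclideanSpace ℝ (Fin n) →L[ℝ] EuclideanSpace ℝ (Fin n)) = fderiv ℝ F xinf) :
    ∃ δ > 0, ∀ x₀ : EuclideanSpace ℝ (Fin n), ‖x₀ - xinf‖ < δ → ∃ ε > 0,
      Metric.ball x₀ ε ⊆ U ∧ xinf ∈ Metric.ball x₀ ε ∧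
      (∀ x ∈ Metric.ball x₀ ε,
        ∃ J : EuclideanSpace ℝ (Fin n) ≃L[ℝ] EuclideanSpace ℝ (Fin n),
          (J : EuclideanSpace ℝ (Fin n) →L[ℝ] EuclideanSpace ℝ (Fin n)) = fderiv ℝ F x) ∧
      ∀ x ∈ Metric.ball x₀ ε, ‖(fderiv ℝ F x).inverse (F x₀)‖ < ε := by
  obtain ⟨J, hJ⟩ := hJ
  have hUn : U ∈ nhds xinf := hU.mem_nhds hmem
  have hFc : ContDiffAt ℝ 2 F xinf := hF.contDiffAt hUn
  have hD : ContinuousAt (fderiv ℝ F) xinf :=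
    (hF.continuousOn_fderiv_of_isOpen hU (by norm_num)).continuousAt hUn
  have hFcont : ContinuousAt F xinf := hFc.continuousAt
  have hinv : ContinuousAt (fun x => ‖(fderiv ℝ F x).inverse‖) xinf := by
    have h1 : ContinuousAt (ContinuousLinearMap.inverse :
        (EuclideanSpace ℝ (Fin n) →L[ℝ] EuclideanSpace ℝ (Fin n)) → _) (fderiv ℝ F xinf) := by
      rw [← hJ]
      exact (contDiffAt_map_inverse (n := 1) J).continuousAt
    exact (ContinuousAt.comp (f := fderiv ℝ F) h1 hD).norm
  obtain ⟨C, hC⟩ : ∃ C, C = ‖(fderiv ℝ F xinf).inverse‖ + 1 := ⟨_, rfl⟩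
  have hCpos : 0 < C := by rw [hC]; positivity
  have e1 : ∀ᶠ x in nhds xinf, ‖(fderiv ℝ F x).inverse‖ < C :=
    hinv.eventually_lt continuousAt_const (by rw [hC]; linarith)
  have e2 : ∀ᶠ x in nhds xinf,
      fderiv ℝ F x ∈ Set.range ((↑) : (EuclideanSpace ℝ (Fin n) ≃L[ℝ] EuclideanSpace ℝ (Fin n)) →
        EuclideanSpace ℝ (Fin n) →L[ℝ] EuclideanSpace ℝ (Fin n)) := by
    apply hD
    rw [← hJ]
    exact ContinuousLinearEquiv.nhds J
  obtain ⟨r, hr, hball⟩ := Metric.eventually_nhds_iff_ball.1 (e1.and (e2.and hUn))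
  have e3 : ∀ᶠ x in nhds xinf, C * ‖F x‖ < r / 2 :=
    (continuousAt_const.mul hFcont.norm).eventually_lt continuousAt_const
      (by simp [hzero, hr])
  obtain ⟨d, hd, hdball⟩ := Metric.eventually_nhds_iff_ball.1 e3
  refine ⟨min d (r / 2), by positivity, fun x₀ hx₀ => ⟨r / 2, by positivity, ?_⟩⟩
  have h1 := lt_of_lt_of_le hx₀ (min_le_left _ _)
  have h2 := lt_of_lt_of_le hx₀ (min_le_right _ _)
  have hsub : ∀ x ∈ Metric.ball x₀ (r / 2), x ∈ Metric.ball xinf r := by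
    intro x hx
    rw [Metric.mem_ball] at hx ⊢
    have := dist_triangle x x₀ xinf
    rw [dist_eq_norm x₀ xinf] at this
    linarith
  refine ⟨fun x hx => (hball x (hsub x hx)).2.2, ?_, fun x hx => (hball x (hsub x hx)).2.1, ?_⟩
  · rw [Metric.mem_ball, dist_comm, dist_eq_norm]; exact h2
  · intro x hx
    have h3 := hdball x₀ (by rw [Metric.mem_ball, dist_eq_norm]; exact h1)
    refine lt_of_le_of_lt (ContinuousLinearMap.le_opNorm _ _) (lt_of_le_of_lt ?_ h3)
    exact mul_le_mul_of_nonneg_right (hball x (hsub x hx)).1.le (norm_nonneg _)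
end

section
/- Two nonempty compact metric spaces admitting arbitrarily good approximate isometries between finite nets are isometric. Precisely: let X₁ and X₂ be nonempty compact metric spaces. Suppose that for every ε > 0 there exist a finite subset S₁ ⊆ X₁ which is an ε-net of X₁ (every point of X₁ is within distance ε of some point of S₁) and a map f : S₁ → X₂ whose image is an ε-net of X₂ (every point of X₂ is within distance ε of some point f(s), s ∈ S₁), such that |dist(f(s), f(t)) − dist(s, t)| ≤ 2ε for all s, t ∈ S₁. Then X₁ and X₂ are isometric, i.e., there exists a distance-preserving bijection X₁ ≃ X₂. -/
/-- Two nonempty compact metric spaces admitting, for every `ε > 0`, a finite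
`ε`-net `S₁` of the first space and a map `f` on `S₁` whose image is an
`ε`-net of the second space and which distorts distances between points of
`S₁` by at most `2ε`, are isometric. -/
theorem isometric_of_approx_isometries_on_nets
    {X₁ X₂ : Type*} [MetricSpace X₁] [MetricSpace X₂]
    [CompactSpace X₁] [CompactSpace X₂] [Nonempty X₁] [Nonempty X₂]
    (h : ∀ ε : ℝ, 0 < ε → ∃ S₁ : Finset X₁,
      (∀ x : X₁, ∃ s ∈ S₁, dist x s ≤ ε) ∧
      ∃ f : X₁ → X₂,
        (∀ y : X₂, ∃ s ∈ S₁, dist y (f s) ≤ ε) ∧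
        ∀ s ∈ S₁, ∀ t ∈ S₁, |dist (f s) (f t) - dist s t| ≤ 2 * ε) :
    Nonempty (X₁ ≃ᵢ X₂) := by
  rw [← GromovHausdorff.toGHSpace_eq_toGHSpace_iff_isometryEquiv]
  apply eq_of_dist_eq_zero
  apply le_antisymm _ dist_nonneg
  apply le_of_forall_pos_le_add
  intro δ hδ
  obtain ⟨S, hS, f, hf, hd⟩ := h (δ / 3) (by positivity)
  have key := GromovHausdorff.ghDist_le_of_approx_subsets (X := X₁) (Y := X₂)
    (s := {x | x ∈ S}) (fun x => f x.1) (ε₁ := δ / 3) (ε₂ := 2 * (δ / 3)) (ε₃ := δ / 3)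
    (fun x => hS x)
    (fun y => by
      obtain ⟨s, hs, h1⟩ := hf y
      exact ⟨⟨s, hs⟩, h1⟩)
    (fun x y => by
      rw [abs_sub_comm]
      exact hd x.1 x.2 y.1 y.2)
  unfold GromovHausdorff.ghDist at key
  linarith
end

section
/- (Tarski–Seidenberg, decidability of real solvability) Fix n. Encode a polynomial in n real variables with rational coefficients as a finite list of monomial–coefficient pairs, i.e., an element of List ((Fin n → ℕ) × ℚ), with evaluation eval(L)(x) = ∑_{(e,c) ∈ L} c · ∏_{i} x(i)^{e(i)} for x : Fin n → ℝ. Then the predicate on pairs of finite lists (P, Q) of such encoded polynomials asserting 'there exists x : Fin n → ℝ such that eval(p)(x) = 0 for every p ∈ P and eval(q)(x) > 0 for every q ∈ Q' is a computable predicate. In particular, it is recursive to determine whether a finite list of polynomial equalities and strict inequalities with rational coefficients has a common real solution. -/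
/-- Real evaluation of a polynomial in `n` variables with rational
coefficients, encoded as a list of (exponent vector, coefficient) pairs. -/
def encodedPolyEval (n : ℕ) (L : List ((Fin n → ℕ) × ℚ)) (x : Fin n → ℝ) : ℝ :=
  (L.map fun ec => (ec.2 : ℝ) * ∏ i : Fin n, x i ^ ec.1 i).sum



namespace TS

open Encodable

/-- Codes of rationals. -/
def ratCode (q : ℚ) : ℕ := Nat.pair (encode q.num) q.den

theorem ratCode_eq (q : ℚ) : @encode ℚ Rat.instEncodable q = ratCode q := rfl

theorem int_code_nat (n : ℕ) : encode (n : ℤ) = 2 * n := rfl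
theorem int_code_neg (n : ℕ) : encode (Int.negSucc n) = 2 * n + 1 := rfl

/-- numerator parts from the integer code -/
def posPart (k : ℕ) : ℕ := if k % 2 = 0 then k / 2 else 0
def negPart (k : ℕ) : ℕ := if k % 2 = 0 then 0 else k / 2 + 1

theorem pos_neg (a : ℤ) : ((posPart (encode a) : ℕ) : ℤ) - (negPart (encode a) : ℕ) = a := by
  cases a with
  | ofNat n =>
    have : encode (Int.ofNat n) = 2 * n := rfl
    rw [this]; simp [posPart, negPart]
  | negSucc n =>
    rw [int_code_neg]
    have h1 : (2 * n + 1) % 2 = 1 := by omega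
    have h2 : (2 * n + 1) / 2 = n := by omega
    simp [posPart, negPart, h1, h2]; omega

def IsCode (k : ℕ) : Prop :=
  0 < k.unpair.2 ∧ ∀ d < k.unpair.2 + 1,
    ((posPart k.unpair.1 + negPart k.unpair.1) % d = 0 ∧ k.unpair.2 % d = 0) → d = 1

theorem natAbs_code (a : ℤ) : posPart (encode a) + negPart (encode a) = a.natAbs := by
  cases a with
  | ofNat n =>
    have : encode (Int.ofNat n) = 2 * n := rfl
    rw [this]; simp [posPart, negPart]
  | negSucc n =>
    rw [int_code_neg]
    have h1 : (2 * n + 1) % 2 = 1 := by omega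
    have h2 : (2 * n + 1) / 2 = n := by omega
    simp [posPart, negPart, h1, h2]

theorem isCode_iff (k : ℕ) : IsCode k ↔ k ∈ Set.range (@encode ℚ Rat.instEncodable) := by
  constructor
  · rintro ⟨h0, h⟩
    obtain ⟨a, ha⟩ : ∃ a : ℤ, encode a = k.unpair.1 := by
      rcases Nat.even_or_odd' k.unpair.1 with ⟨m, hm | hm⟩
      · exact ⟨m, by rw [hm]; rfl⟩
      · exact ⟨Int.negSucc m, by rw [hm]; rfl⟩
    rw [← ha, natAbs_code] at h
    have hc : a.natAbs.Coprime k.unpair.2 := by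
      apply h (Nat.gcd a.natAbs k.unpair.2)
      · exact Nat.lt_succ_of_le (Nat.gcd_le_right _ h0)
      · exact ⟨Nat.mod_eq_zero_of_dvd (Nat.gcd_dvd_left _ _),
          Nat.mod_eq_zero_of_dvd (Nat.gcd_dvd_right _ _)⟩
    refine ⟨⟨a, k.unpair.2, h0.ne', hc⟩, ?_⟩
    rw [ratCode_eq, ratCode]
    simp [ha]
  · rintro ⟨q, rfl⟩
    rw [ratCode_eq, IsCode, ratCode]
    simp only [Nat.unpair_pair, natAbs_code]
    refine ⟨q.den_pos, fun d _ ⟨h1, h2⟩ => ?_⟩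
    have := Nat.dvd_gcd (Nat.dvd_of_mod_eq_zero h1) (Nat.dvd_of_mod_eq_zero h2)
    rw [Nat.Coprime.gcd_eq_one q.reduced] at this
    exact Nat.dvd_one.1 this

theorem primrec_posPart : Primrec posPart :=
  Primrec.ite (Primrec.eq.comp (Primrec.nat_mod.comp Primrec.id (Primrec.const 2)) (Primrec.const 0))
    (Primrec.nat_div.comp Primrec.id (Primrec.const 2)) (Primrec.const 0)

theorem primrec_negPart : Primrec negPart :=
  Primrec.ite (Primrec.eq.comp (Primrec.nat_mod.comp Primrec.id (Primrec.const 2)) (Primrec.const 0))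
    (Primrec.const 0) (Primrec.succ.comp (Primrec.nat_div.comp Primrec.id (Primrec.const 2)))

theorem primrecPred_isCode : PrimrecPred IsCode := by
  have hu2 : Primrec fun k : ℕ => k.unpair.2 := Primrec.snd.comp Primrec.unpair
  have hu1 : Primrec fun k : ℕ => k.unpair.1 := Primrec.fst.comp Primrec.unpair
  have hn : Primrec fun k : ℕ => posPart k.unpair.1 + negPart k.unpair.1 :=
    Primrec.nat_add.comp (primrec_posPart.comp hu1) (primrec_negPart.comp hu1)
  refine PrimrecPred.and (Primrec.nat_lt.comp (Primrec.const 0) hu2) ?_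
  have hR : PrimrecRel fun d k : ℕ =>
      ((posPart k.unpair.1 + negPart k.unpair.1) % d = 0 ∧ k.unpair.2 % d = 0) → d = 1 := by
    have : PrimrecRel fun d k : ℕ =>
      ¬ ((posPart k.unpair.1 + negPart k.unpair.1) % d = 0 ∧ k.unpair.2 % d = 0) ∨ d = 1 := by
      refine PrimrecPred.or (PrimrecPred.not (PrimrecPred.and ?_ ?_)) ?_
      · exact Primrec.eq.comp (Primrec.nat_mod.comp (hn.comp Primrec.snd) Primrec.fst) (Primrec.const 0)
      · exact Primrec.eq.comp (Primrec.nat_mod.comp (hu2.comp Primrec.snd) Primrec.fst) (Primrec.const 0)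
      · exact Primrec.eq.comp Primrec.fst (Primrec.const 1)
    refine this.of_eq fun a b => ?_
    tauto
  exact hR.forall_lt.comp (Primrec.succ.comp hu2) Primrec.id

open Classical in
noncomputable def nextCode (x : ℕ) : ℕ :=
  x + (List.range (Nat.pair (2 * (x + 1)) 1 + 1)).findIdx (fun m => decide (IsCode (x + m + 1))) + 1

open Classical in
theorem primrec_nextCode : Primrec nextCode := by
  refine Primrec.succ.comp (Primrec.nat_add.comp Primrec.id (Primrec.list_findIdx ?_ ?_))
  · exact Primrec.list_range.comp (Primrec.succ.comp (Primrec₂.natPair.comp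
      (Primrec.nat_mul.comp (Primrec.const 2) Primrec.succ) (Primrec.const 1)))
  · have : PrimrecPred fun p : ℕ × ℕ => IsCode (p.1 + p.2 + 1) :=
      primrecPred_isCode.comp (Primrec.succ.comp (Primrec.nat_add.comp Primrec.fst Primrec.snd))
    exact primrecPred_iff_primrec_decide.1 this

open Classical in
theorem nextCode_eq (x : ℕ) (h : ∃ m, IsCode (x + m + 1)) : nextCode x = x + Nat.find h + 1 := by
  have hb : IsCode (Nat.pair (2 * (x + 1)) 1) := by
    rw [isCode_iff]
    exact ⟨((x + 1 : ℕ) : ℚ), rfl⟩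
  have hle := Nat.left_le_pair (2 * (x + 1)) 1
  obtain ⟨m, hm⟩ : ∃ m, Nat.pair (2 * (x + 1)) 1 = x + m + 1 :=
    ⟨Nat.pair (2 * (x + 1)) 1 - x - 1, by omega⟩
  rw [hm] at hb
  unfold nextCode
  have hf : Nat.find h ≤ m := Nat.find_min' h hb
  have hlt : Nat.find h < (List.range (Nat.pair (2 * (x + 1)) 1 + 1)).length := by
    rw [List.length_range]; omega
  have : (List.range (Nat.pair (2 * (x + 1)) 1 + 1)).findIdx
      (fun m => decide (IsCode (x + m + 1))) = Nat.find h := by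
    rw [List.findIdx_eq hlt]
    refine ⟨by simpa using Nat.find_spec h, fun j hj => ?_⟩
    simpa using Nat.find_min h hj
  rw [this]

/-- The `n`th code. -/
noncomputable def nthCode (n : ℕ) : ℕ := ratCode (Denumerable.ofNat ℚ n)

theorem nthCode_eq : ∃ c : ℕ, ∀ n, nthCode n = Nat.rec c (fun _ x => nextCode x) n := by
  classical
  let := @decidableRangeEncode ℚ Rat.instEncodable
  let hinf : Infinite (Set.range (@encode ℚ Rat.instEncodable)) :=
    Infinite.of_injective _ (Equiv.ofInjective _ (@encode_injective ℚ Rat.instEncodable)).injective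
  have key : ∀ n, nthCode n = (Nat.Subtype.ofNat (Set.range (@encode ℚ Rat.instEncodable)) n : ℕ) := by
    intro n
    have h1 : Denumerable.ofNat ℚ n = (@equivRangeEncode ℚ Rat.instEncodable).symm
      (Nat.Subtype.ofNat (Set.range (@encode ℚ Rat.instEncodable)) n) := by
      have : @decode ℚ Rat.instDenumerable.toEncodable n = some ((@equivRangeEncode ℚ Rat.instEncodable).symm
        (Nat.Subtype.ofNat (Set.range (@encode ℚ Rat.instEncodable)) n)) := rfl
      have h2 := Denumerable.decode_eq_ofNat ℚ n
      rw [this] at h2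
      exact (Option.some.inj h2).symm
    rw [nthCode, h1, ← ratCode_eq]
    have h3 := (@equivRangeEncode ℚ Rat.instEncodable).apply_symm_apply
      (Nat.Subtype.ofNat (Set.range (@encode ℚ Rat.instEncodable)) n)
    exact congrArg Subtype.val h3
  refine ⟨nthCode 0, fun n => ?_⟩
  induction n with
  | zero => rfl
  | succ n ih =>
    show nthCode (n+1) = nextCode (Nat.rec (nthCode 0) (fun _ x => nextCode x) n)
    rw [← ih, key, key]
    have hex : ∃ m, IsCode ((Nat.Subtype.ofNat (Set.range (@encode ℚ Rat.instEncodable)) n : ℕ) + m + 1) := by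
      obtain ⟨m, hm⟩ := Nat.Subtype.exists_succ (Nat.Subtype.ofNat (Set.range (@encode ℚ Rat.instEncodable)) n)
      exact ⟨m, (isCode_iff _).2 hm⟩
    rw [nextCode_eq _ hex]
    rw [Nat.Subtype.ofNat, Nat.Subtype.succ]
    simp only
    congr 2
    apply Nat.find_congr'
    intro m
    rw [isCode_iff]

theorem primrec_nthCode : Primrec nthCode := by
  obtain ⟨c, hc⟩ := nthCode_eq
  refine (Primrec.nat_rec₁ c (f := fun _ x => nextCode x) ?_).of_eq (fun n => (hc n).symm)
  exact primrec_nextCode.comp Primrec.snd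

/-- `(a,b,c)` stands for `(a-b)/(c+1)`. -/
abbrev C0 := ℕ × ℕ × ℕ

noncomputable def C0.ev (x : C0) : ℝ := ((x.1 : ℝ) - x.2.1) / (x.2.2 + 1)

def conv (q : ℚ) : C0 :=
  (posPart (encode q.num), negPart (encode q.num), q.den - 1)

theorem conv_ev (q : ℚ) : (conv q).ev = q := by
  have h := pos_neg q.num
  have h' : ((posPart (encode q.num) : ℕ) : ℝ) - (negPart (encode q.num) : ℕ) = q.num := by
    exact_mod_cast h
  have hd : (((q.den - 1 : ℕ) : ℝ) + 1) = q.den := by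
    have := q.den_pos
    have h2 : q.den - 1 + 1 = q.den := by omega
    exact_mod_cast h2
  simp only [conv, C0.ev, h', hd]
  exact (Rat.cast_def q).symm

theorem primrec_conv : Primrec conv := by
  refine Primrec.ofNat_iff.2 ?_
  have h : Primrec fun n => (posPart (nthCode n).unpair.1, negPart (nthCode n).unpair.1,
      (nthCode n).unpair.2 - 1) := by
    have hu2 : Primrec fun k : ℕ => (nthCode k).unpair.2 := Primrec.snd.comp (Primrec.unpair.comp primrec_nthCode)
    have hu1 : Primrec fun k : ℕ => (nthCode k).unpair.1 := Primrec.fst.comp (Primrec.unpair.comp primrec_nthCode)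
    exact (primrec_posPart.comp hu1).pair ((primrec_negPart.comp hu1).pair
      (Primrec.nat_sub.comp hu2 (Primrec.const 1)))
  refine h.of_eq fun n => ?_
  simp [nthCode, ratCode, conv]

end TS

namespace TS

open Encodable

instance signPrimcodable : Primcodable SignType :=
  Primcodable.ofEquiv (Fin 3) SignType.fin3Equiv.toEquiv

/-- A computable ring of functions on `Z`. -/
structure Ops (C Z : Type) [Primcodable C] where
  zero : C
  one : C
  add : C → C → C
  mul : C → C → C
  neg : C → C
  ev : Z → C → ℝ
  p_add : Primrec₂ add
  p_mul : Primrec₂ mul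
  p_neg : Primrec neg
  ev_zero : ∀ z, ev z zero = 0
  ev_one : ∀ z, ev z one = 1
  ev_add : ∀ z a b, ev z (add a b) = ev z a + ev z b
  ev_mul : ∀ z a b, ev z (mul a b) = ev z a * ev z b
  ev_neg : ∀ z a, ev z (neg a) = - ev z a

variable {C Z : Type} [Primcodable C] (O : Ops C Z)

namespace Ops

def nsm (k : ℕ) (a : C) : C := Nat.rec O.zero (fun _ x => O.add x a) k

theorem ev_nsm (z : Z) (k : ℕ) (a : C) : O.ev z (O.nsm k a) = k * O.ev z a := by
  induction k with
  | zero => simp [nsm, O.ev_zero]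
  | succ k ih =>
    have : O.nsm (k+1) a = O.add (O.nsm k a) a := rfl
    rw [this, O.ev_add, ih]; push_cast; ring

theorem p_nsm : Primrec₂ O.nsm := by
  have h : Primrec₂ fun (a : C) (k : ℕ) => (Nat.rec O.zero (fun _ x => O.add x a) k : C) :=
    Primrec.nat_rec (f := fun _ : C => O.zero) (g := fun a (p : ℕ × C) => O.add p.2 a)
      (Primrec.const _) (O.p_add.comp (Primrec.snd.comp Primrec.snd) Primrec.fst)
  exact h.swap

def evU (z : Z) (y : ℝ) : List C → ℝ
  | [] => 0
  | a :: p => O.ev z a * y ^ p.length + evU z y p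

def hd (p : List C) : C := p.getD 0 O.zero

theorem p_hd : Primrec O.hd := (Primrec.list_getD O.zero).comp Primrec.id (Primrec.const 0)

def der : List C → List C
  | [] => []
  | a :: p => if p.length = 0 then [] else O.nsm p.length a :: der p

theorem p_der : Primrec O.der := by
  have h : Primrec fun l : List C => (List.recOn l [] fun b l IH =>
      if l.length = 0 then [] else O.nsm l.length b :: IH : List C) := by
    refine Primrec.list_rec (f := fun l : List C => l) (g := fun _ => ([] : List C))
      (h := fun _ (p : C × List C × List C) => if p.2.1.length = 0 then [] else
        O.nsm p.2.1.length p.1 :: p.2.2) Primrec.id (Primrec.const _) ?_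
    have hl : Primrec fun p : List C × C × List C × List C => p.2.2.1.length :=
      Primrec.list_length.comp (Primrec.fst.comp (Primrec.snd.comp Primrec.snd))
    refine Primrec.ite (Primrec.eq.comp hl (Primrec.const 0)) (Primrec.const _) ?_
    exact Primrec.list_cons.comp (O.p_nsm.comp hl (Primrec.fst.comp Primrec.snd))
      (Primrec.snd.comp (Primrec.snd.comp Primrec.snd))
  refine h.of_eq fun l => ?_
  induction l with
  | nil => rfl
  | cons a p ih => simp only [der]; rw [← ih]

theorem len_der (p : List C) : (O.der p).length = p.length - 1 := by
  induction p with
  | nil => rfl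
  | cons a p ih =>
    simp only [der]
    split_ifs with h
    · simp [h]
    · simp [ih]; omega

theorem hasDerivAt_evU (z : Z) (p : List C) (y : ℝ) :
    HasDerivAt (fun y => O.evU z y p) (O.evU z y (O.der p)) y := by
  induction p with
  | nil => simpa [evU, der] using hasDerivAt_const y (0:ℝ)
  | cons a p ih =>
    have h1 : HasDerivAt (fun y => O.ev z a * y ^ p.length)
      (O.ev z a * (p.length * y ^ (p.length - 1))) y := (hasDerivAt_pow p.length y).const_mul _
    have h := h1.add ih
    refine HasDerivAt.congr_deriv h ?_
    simp only [der]
    split_ifs with h0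
    · have : p = [] := List.length_eq_zero_iff.1 h0
      subst this
      simp [evU, der]
    · simp only [evU, O.ev_nsm, O.len_der]; ring

/-- `α p + β q`, aligned at the leading term. -/
def lin (α β : C) (p q : List C) : List C :=
  (List.range p.length).map fun i => O.add (O.mul α (p.getD i O.zero)) (O.mul β (q.getD i O.zero))

theorem lin_nil (α β : C) (q : List C) : O.lin α β [] q = [] := rfl

theorem lin_cons (α β a : C) (p q : List C) : O.lin α β (a :: p) q =
    O.add (O.mul α a) (O.mul β (O.hd q)) :: O.lin α β p q.tail := by
  simp only [lin, List.length_cons, List.range_succ_eq_map, List.map_cons, List.map_map, hd]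
  congr 1
  apply List.map_congr_left
  intro i _
  cases q <;> simp

theorem len_lin (α β : C) (p q : List C) : (O.lin α β p q).length = p.length := by
  simp [lin]

theorem ev_lin (z : Z) (y : ℝ) (α β : C) (p q : List C) (h : q.length ≤ p.length) :
    O.evU z y (O.lin α β p q) =
      O.ev z α * O.evU z y p + O.ev z β * O.evU z y q * y ^ (p.length - q.length) := by
  induction p generalizing q with
  | nil =>
    have : q = [] := List.length_eq_zero_iff.1 (by simpa using h)
    subst this
    simp [lin_nil, evU]
  | cons a p ih =>
    rw [lin_cons]
    cases q with
    | nil =>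
      simp only [evU, len_lin, O.ev_add, O.ev_mul, hd, List.tail_nil]
      rw [ih [] (by simp)]
      simp [evU, O.ev_zero]; ring
    | cons b q =>
      have hq : q.length ≤ p.length := by simpa using h
      simp only [evU, len_lin, O.ev_add, O.ev_mul, hd, List.tail_cons]
      rw [ih q hq]
      have : y ^ p.length = y ^ q.length * y ^ (p.length - q.length) := by
        rw [← pow_add]; congr 1; omega
      simp only [List.length_cons, Nat.add_sub_add_right, List.getD_cons_zero]
      rw [this]; ring

theorem p_lin {A : Type} [Primcodable A] {α β : A → C} {p q : A → List C} (hα : Primrec α)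
    (hβ : Primrec β) (hp : Primrec p) (hq : Primrec q) :
    Primrec fun x => O.lin (α x) (β x) (p x) (q x) := by
  refine Primrec.list_map (Primrec.list_range.comp (Primrec.list_length.comp hp)) ?_
  refine O.p_add.comp (O.p_mul.comp (hα.comp Primrec.fst) ?_) (O.p_mul.comp (hβ.comp Primrec.fst) ?_)
  · exact (Primrec.list_getD O.zero).comp (hp.comp Primrec.fst) Primrec.snd
  · exact (Primrec.list_getD O.zero).comp (hq.comp Primrec.fst) Primrec.snd

/-- one pseudo-division step -/
def step (p q : List C) : List C :=
  O.lin (O.mul (O.hd q) (O.hd q)) (O.neg (O.mul (O.hd p) (O.hd q))) p.tail q.tail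

theorem p_step : Primrec₂ O.step :=
  O.p_lin (O.p_mul.comp (O.p_hd.comp Primrec.snd) (O.p_hd.comp Primrec.snd))
    (O.p_neg.comp (O.p_mul.comp (O.p_hd.comp Primrec.fst) (O.p_hd.comp Primrec.snd)))
    (Primrec.list_tail.comp Primrec.fst) (Primrec.list_tail.comp Primrec.snd)

theorem len_step (p q : List C) : (O.step p q).length = p.length - 1 := by
  simp [step, len_lin]

theorem ev_step (z : Z) (y : ℝ) (p q : List C) (hq : 1 ≤ q.length) (h : q.length ≤ p.length)
    (h0 : O.evU z y q = 0) :
    O.evU z y (O.step p q) = O.ev z (O.hd q) ^ 2 * O.evU z y p := by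
  cases q with
  | nil => simp at hq
  | cons b q =>
  cases p with
  | nil => simp at h
  | cons a p =>
    have hq' : q.length ≤ p.length := by simpa using h
    simp only [step, List.tail_cons]
    rw [O.ev_lin z y _ _ p q hq']
    simp only [O.ev_neg, O.ev_mul, hd, List.getD_cons_zero]
    simp only [evU] at h0 ⊢
    have h1 : O.evU z y q = - (O.ev z b * y ^ q.length) := by linarith
    rw [h1]
    have : y ^ p.length = y ^ q.length * y ^ (p.length - q.length) := by
      rw [← pow_add]; congr 1; omega
    rw [this]; ring

def prem (p q : List C) : List C := (fun r => O.step r q)^[p.length + 1 - q.length] p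

theorem p_prem : Primrec₂ O.prem := by
  refine Primrec.nat_iterate (f := fun x : List C × List C => x.1.length + 1 - x.2.length)
    (g := fun x => x.1) (h := fun x r => O.step r x.2) ?_ Primrec.fst ?_
  · exact Primrec.nat_sub.comp (Primrec.succ.comp (Primrec.list_length.comp Primrec.fst))
      (Primrec.list_length.comp Primrec.snd)
  · exact O.p_step.comp Primrec.snd (Primrec.snd.comp Primrec.fst)

theorem len_iter (q : List C) (k : ℕ) (p : List C) :
    ((fun r => O.step r q)^[k] p).length = p.length - k := by
  induction k generalizing p with
  | zero => rfl
  | succ k ih => rw [Function.iterate_succ_apply, ih, len_step]; omega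

theorem len_prem (p q : List C) (hq : 1 ≤ q.length) (h : q.length ≤ p.length) :
    (O.prem p q).length = q.length - 1 := by
  rw [prem, len_iter]; omega

theorem sign_prem (z : Z) (y : ℝ) (p q : List C) (hq : 1 ≤ q.length)
    (h0 : O.evU z y q = 0) (hb : O.ev z (O.hd q) ≠ 0) :
    SignType.sign (O.evU z y (O.prem p q)) = SignType.sign (O.evU z y p) := by
  unfold prem
  generalize hk : p.length + 1 - q.length = k
  induction k generalizing p with
  | zero => rfl
  | succ k ih =>
    rw [Function.iterate_succ_apply, ih _ (by rw [len_step]; omega)]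
    rw [O.ev_step z y p q hq (by omega) h0, sign_mul, sign_pos (by positivity), one_mul]

/-! closure -/

def ops (K : List (List C)) : List (List C) :=
  K.flatMap fun p => if 2 ≤ p.length then
    p.tail :: O.der p :: [O.hd p] ::
      (K.flatMap fun q => if 2 ≤ q.length ∧ q.length ≤ p.length then [O.prem p q] else [])
    else []

theorem mem_ops {K : List (List C)} {o : List C} : o ∈ O.ops K ↔ ∃ p ∈ K, 2 ≤ p.length ∧
    (o = p.tail ∨ o = O.der p ∨ o = [O.hd p] ∨
      ∃ q ∈ K, 2 ≤ q.length ∧ q.length ≤ p.length ∧ o = O.prem p q) := by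
  simp only [ops, List.mem_flatMap]
  refine exists_congr fun p => and_congr_right fun hp => ?_
  split_ifs with h
  · simp only [List.mem_cons, List.mem_flatMap, h, true_and]
    refine or_congr_right (or_congr_right (or_congr_right ?_))
    refine exists_congr fun q => and_congr_right fun hq => ?_
    split_ifs with h2
    · simp [h2]
    · simp; tauto
  · simp [h]

theorem p_ops : Primrec O.ops := by
  have hlen : Primrec (List.length : List C → ℕ) := Primrec.list_length
  refine Primrec.list_flatMap Primrec.id ?_
  refine Primrec.ite (Primrec.nat_le.comp (Primrec.const 2) (hlen.comp Primrec.snd)) ?_ (Primrec.const _)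
  refine Primrec.list_cons.comp (Primrec.list_tail.comp Primrec.snd) ?_
  refine Primrec.list_cons.comp (O.p_der.comp Primrec.snd) ?_
  refine Primrec.list_cons.comp
    (Primrec.list_cons.comp (O.p_hd.comp Primrec.snd) (Primrec.const [])) ?_
  refine Primrec.list_flatMap Primrec.fst ?_
  refine Primrec.ite (PrimrecPred.and ?_ ?_) ?_ (Primrec.const _)
  · exact Primrec.nat_le.comp (Primrec.const 2) (hlen.comp Primrec.snd)
  · exact Primrec.nat_le.comp (hlen.comp Primrec.snd) (hlen.comp (Primrec.snd.comp Primrec.fst))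
  · exact Primrec.list_cons.comp (O.p_prem.comp (Primrec.snd.comp Primrec.fst) Primrec.snd)
      (Primrec.const [])

def cstep (K : List (List C)) : List (List C) := K ++ O.ops K

def clo (K : List (List C)) : List (List C) := O.cstep^[K.flatten.length] K

theorem p_clo : Primrec O.clo := by
  refine Primrec.nat_iterate (f := fun K : List (List C) => K.flatten.length)
    (g := fun K => K) (h := fun _ K => O.cstep K)
    (Primrec.list_length.comp Primrec.list_flatten) Primrec.id ?_
  exact Primrec.list_append.comp Primrec.snd (O.p_ops.comp Primrec.snd)

theorem subset_iter (K : List (List C)) (i j : ℕ) (h : i ≤ j) :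
    O.cstep^[i] K ⊆ O.cstep^[j] K := by
  induction j, h using Nat.le_induction with
  | base => exact fun _ h => h
  | succ j _ ih =>
    rw [Function.iterate_succ_apply']
    exact fun x hx => List.mem_append_left _ (ih hx)

theorem len_le_flatten (K : List (List C)) (p : List C) (h : p ∈ K) :
    p.length ≤ K.flatten.length := (List.sublist_flatten_of_mem h).length_le

theorem mem_ops_len {K : List (List C)} {o : List C} (h : o ∈ O.ops K) :
    ∃ p ∈ K, ∃ q ∈ K, o.length < q.length ∧ o.length < p.length ∧
      ∀ K', p ∈ K' → q ∈ K' → o ∈ O.ops K' := by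
  obtain ⟨p, hp, h2, h⟩ := O.mem_ops.1 h
  rcases h with rfl | rfl | rfl | ⟨q, hq, hq2, hqp, rfl⟩
  · exact ⟨p, hp, p, hp, by simp; omega, by simp; omega,
      fun K' hp' _ => O.mem_ops.2 ⟨p, hp', h2, by simp⟩⟩
  · exact ⟨p, hp, p, hp, by rw [len_der]; omega, by rw [len_der]; omega,
      fun K' hp' _ => O.mem_ops.2 ⟨p, hp', h2, by simp⟩⟩
  · exact ⟨p, hp, p, hp, by simp; omega, by simp; omega,
      fun K' hp' _ => O.mem_ops.2 ⟨p, hp', h2, by simp⟩⟩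
  · have := O.len_prem p q (by omega) hqp
    exact ⟨p, hp, q, hq, by omega, by omega,
      fun K' hp' hq' => O.mem_ops.2 ⟨p, hp', h2, by right; right; right; exact ⟨q, hq', hq2, hqp, rfl⟩⟩⟩

theorem level (K : List (List C)) (m : ℕ) (hm : ∀ p ∈ K, p.length ≤ m) (j : ℕ) :
    (∀ p ∈ O.cstep^[j] K, p.length ≤ m) ∧
    ∀ i, ∀ p ∈ O.cstep^[j] K, m ≤ p.length + i → p ∈ O.cstep^[i] K := by
  induction j with
  | zero => exact ⟨hm, fun i p hp _ => O.subset_iter K 0 i (Nat.zero_le _) hp⟩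
  | succ j ih =>
    rw [Function.iterate_succ_apply']
    constructor
    · intro p hp
      rcases List.mem_append.1 hp with hp | hp
      · exact ih.1 p hp
      · obtain ⟨p', hp', _, _, _, h, _⟩ := O.mem_ops_len hp
        have := ih.1 p' hp'
        omega
    · intro i p hp hi
      rcases List.mem_append.1 hp with hp | hp
      · exact ih.2 i p hp hi
      · obtain ⟨p', hp', q', hq', h1, h2, h3⟩ := O.mem_ops_len hp
        have := ih.1 p' hp'
        cases i with
        | zero => omega
        | succ i =>
          rw [Function.iterate_succ_apply']
          exact List.mem_append_right _ (h3 _ (ih.2 i p' hp' (by omega)) (ih.2 i q' hq' (by omega)))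

theorem subset_clo (K : List (List C)) : K ⊆ O.clo K := O.subset_iter K 0 _ (Nat.zero_le _)

theorem ops_clo (K : List (List C)) : O.ops (O.clo K) ⊆ O.clo K := by
  intro o ho
  have h := (O.level K K.flatten.length (len_le_flatten K) (K.flatten.length + 1)).2
    K.flatten.length o
  apply h
  · rw [Function.iterate_succ_apply']
    exact List.mem_append_right _ ho
  · omega

end Ops

end TS

namespace TS

theorem sign_add_of_lt {A E : ℝ} (h : |E| < |A|) : SignType.sign (A + E) = SignType.sign A := by
  rcases lt_trichotomy A 0 with hA | hA | hA
  · rw [abs_of_neg hA] at h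
    rw [sign_neg hA, sign_neg (by linarith [le_abs_self E])]
  · subst hA; simp at h; exact absurd h (not_lt.2 (abs_nonneg _))
  · rw [abs_of_pos hA] at h
    rw [sign_pos hA, sign_pos (by linarith [neg_abs_le E])]

theorem mono_case {f : ℝ → ℝ} {a b : ℝ} (hab : a < b) (hc : ContinuousOn f (Set.Icc a b))
    (hm : StrictMonoOn f (Set.Icc a b)) :
    (SignType.sign (f a) * SignType.sign (f b) = -1 → ∃ x, a < x ∧ x < b ∧ f x = 0 ∧
      (∀ y, a < y → y < x → SignType.sign (f y) = SignType.sign (f a)) ∧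
      (∀ y, x < y → y < b → SignType.sign (f y) = SignType.sign (f b))) ∧
    (SignType.sign (f a) * SignType.sign (f b) ≠ -1 → ∀ y, a < y → y < b →
      SignType.sign (f y) =
        if SignType.sign (f a) = 0 then SignType.sign (f b) else SignType.sign (f a)) := by
  have hA : a ∈ Set.Icc a b := ⟨le_rfl, hab.le⟩
  have hB : b ∈ Set.Icc a b := ⟨hab.le, le_rfl⟩
  have hlt := hm hA hB hab
  have H1 : f a < 0 → 0 < f b → ∃ x, a < x ∧ x < b ∧ f x = 0 ∧
      (∀ y, a < y → y < x → SignType.sign (f y) = SignType.sign (f a)) ∧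
      (∀ y, x < y → y < b → SignType.sign (f y) = SignType.sign (f b)) := by
    intro ha hb
    obtain ⟨x, hx, hx0⟩ := intermediate_value_Ioo hab.le hc (show (0:ℝ) ∈ Set.Ioo (f a) (f b) from ⟨ha, hb⟩)
    have hX : x ∈ Set.Icc a b := ⟨hx.1.le, hx.2.le⟩
    refine ⟨x, hx.1, hx.2, hx0, fun y h1 h2 => ?_, fun y h1 h2 => ?_⟩
    · have := hm ⟨h1.le, (h2.trans hx.2).le⟩ hX h2
      rw [sign_neg ha, sign_neg (by linarith)]
    · have := hm hX ⟨(hx.1.trans h1).le, h2.le⟩ h1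
      rw [sign_pos hb, sign_pos (by linarith)]
  constructor
  · intro h
    rcases lt_trichotomy (f a) 0 with ha | ha | ha
    · rcases lt_trichotomy (f b) 0 with hb | hb | hb
      · rw [sign_neg ha, sign_neg hb] at h; exact absurd h (by decide)
      · rw [hb] at h; simp at h
      · exact H1 ha hb
    · rw [ha] at h; simp at h
    · rw [sign_pos ha, sign_pos (ha.trans hlt)] at h; exact absurd h (by decide)
  · intro h y h1 h2
    have hy1 := hm hA ⟨h1.le, h2.le⟩ h1
    have hy2 := hm ⟨h1.le, h2.le⟩ hB h2
    rcases lt_trichotomy (f a) 0 with ha | ha | ha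
    · have hb : f b ≤ 0 := by
        by_contra hb
        push Not at hb
        rw [sign_neg ha, sign_pos hb] at h; exact h (by decide)
      rw [sign_neg ha, sign_neg (by linarith)]; simp
    · rw [ha, sign_pos (by linarith : 0 < f y), sign_pos (by linarith : 0 < f b)]; simp
    · rw [sign_pos ha, sign_pos (by linarith)]; simp

theorem inj_case {f : ℝ → ℝ} {a b : ℝ} (hab : a < b) (hc : ContinuousOn f (Set.Icc a b))
    (hm : Set.InjOn f (Set.Icc a b)) :
    (SignType.sign (f a) * SignType.sign (f b) = -1 → ∃ x, a < x ∧ x < b ∧ f x = 0 ∧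
      (∀ y, a < y → y < x → SignType.sign (f y) = SignType.sign (f a)) ∧
      (∀ y, x < y → y < b → SignType.sign (f y) = SignType.sign (f b))) ∧
    (SignType.sign (f a) * SignType.sign (f b) ≠ -1 → ∀ y, a < y → y < b →
      SignType.sign (f y) =
        if SignType.sign (f a) = 0 then SignType.sign (f b) else SignType.sign (f a)) := by
  rcases ContinuousOn.strictMonoOn_of_injOn_Icc' hab.le hc hm with h | h
  · exact mono_case hab hc h
  · have hn : StrictMonoOn (fun x => - f x) (Set.Icc a b) := fun x hx y hy hxy => neg_lt_neg (h hx hy hxy)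
    have := mono_case hab hc.neg hn
    have hz : ∀ s : SignType, -s = 0 ↔ s = 0 := by decide
    have hite : ∀ s t u : SignType, (-s = if t = 0 then -u else -t) ↔ s = if t = 0 then u else t := by
      decide
    simpa only [Pi.neg_apply, hz, hite, Left.sign_neg, neg_mul_neg, neg_eq_zero, neg_inj] using this

namespace Ops

variable {C Z : Type} [Primcodable C] (O : Ops C Z)

theorem evU_bound (z : Z) (p : List C) : ∃ M : ℝ, 0 ≤ M ∧ ∀ y : ℝ, 1 ≤ |y| →
    |O.evU z y p| * |y| ≤ M * |y| ^ p.length := by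
  induction p with
  | nil => exact ⟨0, le_rfl, fun y _ => by simp [evU]⟩
  | cons a p ih =>
    obtain ⟨M, hM, h⟩ := ih
    refine ⟨|O.ev z a| + M, by positivity, fun y hy => ?_⟩
    have h1 := h y hy
    have h2 : |O.evU z y (a :: p)| ≤ |O.ev z a| * |y| ^ p.length + |O.evU z y p| := by
      simp only [evU]
      refine (abs_add_le _ _).trans ?_
      rw [abs_mul, abs_pow]
    have h3 : |y| ^ p.length ≤ |y| ^ p.length * |y| := le_mul_of_one_le_right (by positivity) hy
    have h4 := mul_le_mul_of_nonneg_right h2 (abs_nonneg y)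
    have h5 := mul_le_mul_of_nonneg_left h3 hM
    rw [List.length_cons, pow_succ]
    nlinarith

theorem sign_large (z : Z) (p : List C) (hp : O.ev z (O.hd p) ≠ 0) : ∃ R : ℝ, ∀ y : ℝ, R ≤ |y| →
    SignType.sign (O.evU z y p) = SignType.sign (O.ev z (O.hd p) * y ^ (p.length - 1)) := by
  cases p with
  | nil => exact absurd (O.ev_zero z) hp
  | cons a p =>
    have ha : O.ev z a ≠ 0 := hp
    obtain ⟨M, hM, h⟩ := O.evU_bound z p
    refine ⟨max 1 (M / |O.ev z a| + 1), fun y hy => ?_⟩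
    have hy1 : 1 ≤ |y| := (le_max_left _ _).trans hy
    have hy2 : M / |O.ev z a| + 1 ≤ |y| := (le_max_right _ _).trans hy
    have hy0 : 0 < |y| := by linarith
    have ha' : 0 < |O.ev z a| := abs_pos.2 ha
    simp only [evU, hd, List.getD_cons_zero, List.length_cons, Nat.add_sub_cancel]
    apply sign_add_of_lt
    rw [abs_mul, abs_pow]
    have h1 := h y hy1
    have h2 : M < |O.ev z a| * |y| := by
      have : M / |O.ev z a| < |y| := by linarith
      rw [div_lt_iff₀ ha'] at this; linarith
    have h3 : 0 < |y| ^ p.length := by positivity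
    have h4 := mul_lt_mul_of_pos_right h2 h3
    by_contra hcon
    push Not at hcon
    have h5 := mul_le_mul_of_nonneg_right hcon hy0.le
    nlinarith

theorem exists_R (z : Z) (K : List (List C)) : ∃ R : ℝ, 2 ≤ R ∧ ∀ p ∈ K, O.ev z (O.hd p) ≠ 0 →
    ∀ y : ℝ, R - 1 ≤ |y| →
    SignType.sign (O.evU z y p) = SignType.sign (O.ev z (O.hd p) * y ^ (p.length - 1)) := by
  induction K with
  | nil => exact ⟨2, le_rfl, by simp⟩
  | cons q K ih =>
    obtain ⟨R, hR, h⟩ := ih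
    by_cases hq : O.ev z (O.hd q) = 0
    · refine ⟨R, hR, fun p hp h0 => ?_⟩
      rcases List.mem_cons.1 hp with rfl | hp
      · exact absurd hq h0
      · exact h p hp h0
    · obtain ⟨R', h'⟩ := O.sign_large z q hq
      refine ⟨max R (R' + 1), hR.trans (le_max_left _ _), fun p hp h0 y hy => ?_⟩
      have h1 := le_max_left R (R' + 1)
      have h2 := le_max_right R (R' + 1)
      rcases List.mem_cons.1 hp with rfl | hp
      · exact h' y (by linarith)
      · exact h p hp h0 y (by linarith)

theorem hd_der (z : Z) (p : List C) (h2 : 2 ≤ p.length) (h : O.ev z (O.hd p) ≠ 0) :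
    O.ev z (O.hd (O.der p)) ≠ 0 := by
  cases p with
  | nil => simp at h2
  | cons a p =>
    have h0 : p.length ≠ 0 := by simp at h2; omega
    simp only [der, if_neg h0, hd, List.getD_cons_zero, O.ev_nsm]
    exact mul_ne_zero (by exact_mod_cast h0) h

theorem not_zero_on (z : Z) (n : ℕ) : ∀ (p : List C), p.length = n + 1 → O.ev z (O.hd p) ≠ 0 →
    ∀ a b : ℝ, a < b → ¬ ∀ y, a < y → y < b → O.evU z y p = 0 := by
  induction n with
  | zero =>
    intro p hp h0 a b hab h
    obtain ⟨c, rfl⟩ := List.length_eq_one_iff.1 hp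
    have := h ((a + b) / 2) (by linarith) (by linarith)
    simp [evU] at this
    exact h0 this
  | succ n ih =>
    intro p hp h0 a b hab h
    refine ih (O.der p) (by rw [O.len_der]; omega) (O.hd_der z p (by omega) h0) a b hab ?_
    intro y h1 h2
    have hd := O.hasDerivAt_evU z p y
    have he : (fun y => O.evU z y p) =ᶠ[nhds y] fun _ => (0:ℝ) := by
      filter_upwards [Ioo_mem_nhds h1 h2] with t ht
      exact h t ht.1 ht.2
    have hd' := hd.congr_of_eventuallyEq he.symm
    exact hd'.unique (hasDerivAt_const y 0)

theorem continuous_evU (z : Z) (p : List C) : Continuous fun y => O.evU z y p :=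
  continuous_iff_continuousAt.2 fun y => (O.hasDerivAt_evU z p y).continuousAt

theorem injOn (z : Z) (p : List C) (h2 : 2 ≤ p.length) (h : O.ev z (O.hd p) ≠ 0) {a b : ℝ}
    (hab : a < b) (s : SignType)
    (hs : ∀ y, a < y → y < b → SignType.sign (O.evU z y (O.der p)) = s) :
    Set.InjOn (fun y => O.evU z y p) (Set.Icc a b) := by
  have hs0 : s ≠ 0 := by
    rintro rfl
    refine O.not_zero_on z (p.length - 2) (O.der p) (by rw [O.len_der]; omega)
      (O.hd_der z p h2 h) a b hab fun y h1 h2 => ?_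
    exact sign_eq_zero_iff.1 (hs y h1 h2)
  have key : ∀ u v, u ∈ Set.Icc a b → v ∈ Set.Icc a b → u < v → O.evU z u p ≠ O.evU z v p := by
    intro u v hu hv huv heq
    obtain ⟨c, hc, hc0⟩ := exists_hasDerivAt_eq_zero (f := fun y => O.evU z y p)
      (f' := fun y => O.evU z y (O.der p)) huv
      (O.continuous_evU z p).continuousOn heq (fun x _ => O.hasDerivAt_evU z p x)
    have := hs c (lt_of_le_of_lt hu.1 hc.1) (lt_of_lt_of_le hc.2 hv.2)
    rw [hc0, sign_zero] at this
    exact hs0 this.symm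
  intro u hu v hv huv
  by_contra hne
  rcases lt_or_gt_of_ne hne with hlt | hlt
  · exact key u v hu hv hlt huv
  · exact key v u hv hu hlt huv.symm

theorem evU_tail (z : Z) (y : ℝ) (p : List C) (h : O.ev z (O.hd p) = 0) :
    O.evU z y p = O.evU z y p.tail := by
  cases p with
  | nil => rfl
  | cons a p =>
    have : O.ev z a = 0 := h
    simp [evU, this]

theorem evU_short (z : Z) (y : ℝ) (p : List C) (h : p.length ≤ 1) :
    O.evU z y p = O.ev z (O.hd p) := by
  match p, h with
  | [], _ => simp [evU, hd, O.ev_zero]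
  | [a], _ => simp [evU, hd]

end Ops

end TS

namespace TS

abbrev Col (C : Type) := List (List C × SignType)

theorem p_sign1 {A : Type} [Primcodable A] (g : SignType → SignType) {f : A → SignType}
    (hf : Primrec f) : Primrec fun x => g (f x) := by
  exact (Primrec.dom_finite g).comp hf

theorem p_sign2 {A : Type} [Primcodable A] (g : SignType → SignType → SignType)
    {f f' : A → SignType} (hf : Primrec f) (hf' : Primrec f') : Primrec fun x => g (f x) (f' x) := by
  have h := (Primrec.dom_finite fun p : SignType × SignType => g p.1 p.2).comp (hf.pair hf')
  exact h

section look

variable {C : Type} [Primcodable C]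

open Classical in
noncomputable def look (p : List C) (c : Col C) : SignType :=
  (@List.lookup (List C) SignType instBEqOfDecidableEq p c).getD 0

open Classical in
theorem p_look : Primrec₂ (look : List C → Col C → SignType) :=
  Primrec.option_getD.comp (Primrec.listLookup.comp Primrec.fst Primrec.snd) (Primrec.const 0)

theorem lookup_map {α : Type} [BEq α] [LawfulBEq α] (σ : α → SignType) (G : List α) (q : α) (h : q ∈ G) :
    (G.map fun p => (p, σ p)).lookup q = some (σ q) := by
  induction G with
  | nil => simp at h
  | cons p G ih =>
    rw [List.map_cons, List.lookup_cons]
    by_cases hpq : q = p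
    · subst hpq; simp
    · have h' : q ∈ G := by
        rcases List.mem_cons.1 h with h | h
        · exact absurd h hpq
        · exact h
      have : (q == p) = false := by simpa using hpq
      rw [this]
      exact ih h'

open Classical in
theorem look_map (σ : List C → SignType) (G : List (List C)) (q : List C) (h : q ∈ G) :
    look q (G.map fun p => (p, σ p)) = σ q := by
  unfold look
  rw [@lookup_map (List C) instBEqOfDecidableEq inferInstance σ G q h]
  rfl

end look

namespace Ops

variable {C Z : Type} [Primcodable C] (O : Ops C Z)

noncomputable def cands (p : List C) (d : Col C) : List SignType :=
  d.filterMap fun qs => if 2 ≤ qs.1.length ∧ qs.2 = 0 ∧ look [O.hd qs.1] d ≠ 0 then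
    some (look (O.prem p qs.1) d) else none

noncomputable def ptSign (p : List C) (d : Col C) : SignType :=
  (O.cands p d).head?.getD
    (if p.length % 2 = 1 then look [O.hd p] d else - look [O.hd p] d)

theorem p_lookhd {A : Type} [Primcodable A] {p : A → List C} {d : A → Col C}
    (hp : Primrec p) (hd : Primrec d) : Primrec fun x => look [O.hd (p x)] (d x) :=
  p_look.comp (Primrec.list_cons.comp (O.p_hd.comp hp) (Primrec.const [])) hd

theorem p_cands : Primrec₂ O.cands := by
  refine Primrec.listFilterMap Primrec.snd ?_
  have hq : Primrec fun x : (List C × Col C) × (List C × SignType) => x.2.1 :=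
    Primrec.fst.comp Primrec.snd
  have hd : Primrec fun x : (List C × Col C) × (List C × SignType) => x.1.2 :=
    Primrec.snd.comp Primrec.fst
  refine Primrec.ite (PrimrecPred.and ?_ (PrimrecPred.and ?_ (PrimrecPred.not ?_))) ?_ (Primrec.const none)
  · exact Primrec.nat_le.comp (Primrec.const 2) (Primrec.list_length.comp hq)
  · exact Primrec.eq.comp (Primrec.snd.comp Primrec.snd) (Primrec.const 0)
  · exact Primrec.eq.comp (O.p_lookhd hq hd) (Primrec.const 0)
  · exact Primrec.option_some.comp (p_look.comp (O.p_prem.comp (Primrec.fst.comp Primrec.fst) hq) hd)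

theorem p_ptSign : Primrec₂ O.ptSign := by
  refine Primrec.option_getD.comp (Primrec.list_head?.comp (O.p_cands.comp Primrec.fst Primrec.snd)) ?_
  have h := O.p_lookhd (p := fun x : List C × Col C => x.1) (d := fun x => x.2) Primrec.fst Primrec.snd
  refine Primrec.ite ?_ h (p_sign1 (fun s => -s) h)
  exact Primrec.eq.comp (Primrec.nat_mod.comp (Primrec.list_length.comp Primrec.fst) (Primrec.const 2))
    (Primrec.const 1)

def ref (p : List C) (sL : SignType) (de : Col C × Col C) (sR : SignType) : List (Col C × Col C) :=
  if sL * sR = -1 then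
    [((p, sL) :: de.1, (p, sL) :: de.2), ((p, 0) :: de.2, (p, sR) :: de.2)]
  else [((p, sL) :: de.1, (p, if sL = 0 then sR else sL) :: de.2)]

theorem p_ref {A : Type} [Primcodable A] {p : A → List C} {sL sR : A → SignType}
    {de : A → Col C × Col C} (hp : Primrec p) (hL : Primrec sL) (hR : Primrec sR) (hde : Primrec de) :
    Primrec fun x => ref (p x) (sL x) (de x) (sR x) := by
  have hd := Primrec.fst.comp hde
  have he := Primrec.snd.comp hde
  have hc : ∀ {s : A → SignType} {c : A → Col C}, Primrec s → Primrec c →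
      Primrec fun x => (p x, s x) :: c x := fun hs hc => Primrec.list_cons.comp (hp.pair hs) hc
  refine Primrec.ite ?_ ?_ ?_
  · exact Primrec.eq.comp (p_sign2 (· * ·) hL hR) (Primrec.const (-1))
  · exact Primrec.list_cons.comp ((hc hL hd).pair (hc hL he)) (Primrec.list_cons.comp
      ((hc (Primrec.const 0) he).pair (hc hR he)) (Primrec.const []))
  · exact Primrec.list_cons.comp ((hc hL hd).pair
      (hc (p_sign2 (fun s t => if s = 0 then t else s) hL hR) he)) (Primrec.const [])

def nextSign (s0 : SignType) (acc : List (Col C × Col C)) : SignType :=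
  ((acc.head?.bind fun de => de.1.head?).map Prod.snd).getD s0

theorem p_nextSign : Primrec₂ (nextSign : SignType → List (Col C × Col C) → SignType) := by
  refine Primrec.option_getD.comp (Primrec.option_map (Primrec.option_bind
    (Primrec.list_head?.comp Primrec.snd) ?_) ?_) Primrec.fst
  · exact Primrec.list_head?.comp (Primrec.fst.comp Primrec.snd)
  · exact Primrec.snd.comp Primrec.snd

noncomputable def addF (p : List C) (de : Col C × Col C) (acc : List (Col C × Col C)) :
    List (Col C × Col C) :=
  if look [O.hd p] de.1 = 0 then
    ((p, look p.tail de.1) :: de.1, (p, look p.tail de.2) :: de.2) :: acc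
  else ref p (O.ptSign p de.1) de (nextSign (look [O.hd p] de.1) acc) ++ acc

noncomputable def addP (p : List C) (D : List (Col C × Col C)) : List (Col C × Col C) :=
  D.foldr (O.addF p) []

theorem p_addP : Primrec₂ O.addP := by
  refine Primrec.list_foldr (f := fun x : List C × List (Col C × Col C) => x.2)
    (g := fun _ => []) (h := fun x (y : (Col C × Col C) × List (Col C × Col C)) =>
      O.addF x.1 y.1 y.2) Primrec.snd (Primrec.const []) ?_
  let A := (List C × List (Col C × Col C)) × ((Col C × Col C) × List (Col C × Col C))
  have hp : Primrec fun x : A => x.1.1 := Primrec.fst.comp Primrec.fst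
  have hde : Primrec fun x : A => x.2.1 := Primrec.fst.comp Primrec.snd
  have hd : Primrec fun x : A => x.2.1.1 := Primrec.fst.comp hde
  have he : Primrec fun x : A => x.2.1.2 := Primrec.snd.comp hde
  have hacc : Primrec fun x : A => x.2.2 := Primrec.snd.comp Primrec.snd
  have hs0 := O.p_lookhd hp hd
  have ht : Primrec fun x : A => x.1.1.tail := Primrec.list_tail.comp hp
  refine Primrec.ite (Primrec.eq.comp hs0 (Primrec.const 0)) ?_ ?_
  · exact Primrec.list_cons.comp
      ((Primrec.list_cons.comp (hp.pair (p_look.comp ht hd)) hd).pair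
        (Primrec.list_cons.comp (hp.pair (p_look.comp ht he)) he)) hacc
  · exact Primrec.list_append.comp
      (p_ref hp (O.p_ptSign.comp hp hd) (p_nextSign.comp hs0 hacc) hde) hacc

/-! ### semantics -/

noncomputable def sg (z : Z) (p : List C) (y : ℝ) : SignType := SignType.sign (O.evU z y p)

noncomputable def colOf (z : Z) (G : List (List C)) (y : ℝ) : Col C := G.map fun q => (q, O.sg z q y)

theorem look_colOf (z : Z) (G : List (List C)) (y : ℝ) (q : List C) (h : q ∈ G) :
    look q (O.colOf z G y) = O.sg z q y := look_map (fun q => O.sg z q y) G q h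

theorem colOf_cons (z : Z) (p : List C) (G : List (List C)) (y : ℝ) :
    O.colOf z (p :: G) y = (p, O.sg z p y) :: O.colOf z G y := rfl

theorem sg_hd (z : Z) (p : List C) (y : ℝ) : O.sg z [O.hd p] y = SignType.sign (O.ev z (O.hd p)) := by
  simp [sg, evU]

def IsRt (z : Z) (G : List (List C)) (a : ℝ) : Prop :=
  ∃ q ∈ G, 2 ≤ q.length ∧ O.ev z (O.hd q) ≠ 0 ∧ O.evU z a q = 0

def Diag (z : Z) (R : ℝ) (G : List (List C)) : ℝ → List (Col C × Col C) → Prop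
  | a, [] => a = R
  | a, de :: t => de.1 = O.colOf z G a ∧ (a = -R ∨ O.IsRt z G a) ∧
      ∃ b, a < b ∧ (∀ y, a < y → y < b → de.2 = O.colOf z G y) ∧ Diag z R G b t

theorem IsRt.cons {O : Ops C Z} {z : Z} {G : List (List C)} {a : ℝ} (p : List C)
    (h : O.IsRt z G a) : O.IsRt z (p :: G) a := by
  obtain ⟨q, hq, h⟩ := h
  exact ⟨q, List.mem_cons_of_mem _ hq, h⟩

/-- What is needed for adding `p`. -/
structure AddOK (z : Z) (R : ℝ) (p : List C) (G : List (List C)) : Prop where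
  len : 2 ≤ p.length
  tail : p.tail ∈ G
  der : O.der p ∈ G
  hd : [O.hd p] ∈ G
  hdG : ∀ q ∈ G, 2 ≤ q.length → [O.hd q] ∈ G
  prem : ∀ q ∈ G, 2 ≤ q.length → O.prem p q ∈ G
  large : O.ev z (O.hd p) ≠ 0 → ∀ y : ℝ, R - 1 ≤ |y| →
    SignType.sign (O.evU z y p) = SignType.sign (O.ev z (O.hd p) * y ^ (p.length - 1))

theorem ptSign_correct (z : Z) (R : ℝ) (hR : 2 ≤ R) (p : List C) (G : List (List C))
    (h : O.AddOK z R p G) (h0 : O.ev z (O.hd p) ≠ 0) (a : ℝ) (ha : a = -R ∨ O.IsRt z G a) :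
    O.ptSign p (O.colOf z G a) = O.sg z p a := by
  have hmem : ∀ s ∈ O.cands p (O.colOf z G a), s = O.sg z p a := by
    intro s hs
    obtain ⟨⟨q, t⟩, hq, hs⟩ := List.mem_filterMap.1 hs
    obtain ⟨q', hq', heq⟩ := List.mem_map.1 hq
    obtain ⟨rfl, rfl⟩ := Prod.mk.inj heq
    simp only at hs
    split_ifs at hs with hc
    obtain ⟨h2, hs0, hne⟩ := hc
    rw [O.look_colOf _ _ _ _ (h.prem _ hq' h2)] at hs
    rw [O.look_colOf _ _ _ _ (h.hdG _ hq' h2), sg_hd] at hne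
    rw [← Option.some.inj hs]
    refine O.sign_prem z a p q' (by omega) (sign_eq_zero_iff.1 hs0) ?_
    intro h; rw [h] at hne; simp at hne
  unfold ptSign
  rcases hc : O.cands p (O.colOf z G a) with _ | ⟨s, l⟩
  · rcases ha with rfl | ⟨q, hq, h2, hne, hq0⟩
    · rw [O.look_colOf _ _ _ _ h.hd, sg_hd]
      simp only [List.head?_nil, Option.getD_none, sg]
      rw [h.large h0 (-R) (by rw [abs_neg, abs_of_nonneg] <;> linarith), sign_mul]
      have hlen := h.len
      split_ifs with hp
      · have : Even (p.length - 1) := by rw [Nat.even_iff]; omega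
        rw [sign_pos (this.pow_pos (by linarith)), mul_one]
      · have : Odd (p.length - 1) := by rw [Nat.odd_iff]; omega
        rw [sign_neg (this.pow_neg (by linarith)), mul_neg_one]
    · exfalso
      have : look (O.prem p q) (O.colOf z G a) ∈ O.cands p (O.colOf z G a) := by
        refine List.mem_filterMap.2 ⟨(q, O.sg z q a), List.mem_map.2 ⟨q, hq, rfl⟩, ?_⟩
        rw [if_pos]
        refine ⟨h2, by simp [sg, hq0], ?_⟩
        rw [O.look_colOf _ _ _ _ (h.hdG _ hq h2), sg_hd]
        simpa using hne
      rw [hc] at this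
      simp at this
  · have := hmem s (by rw [hc]; simp)
    simp [this]

theorem diag_add (z : Z) (R : ℝ) (hR : 2 ≤ R) (p : List C) (G : List (List C))
    (h : O.AddOK z R p G) (D : List (Col C × Col C)) : ∀ a, O.Diag z R G a D →
    O.Diag z R (p :: G) a (O.addP p D) := by
  induction D with
  | nil => intro a ha; exact ha
  | cons de t ih =>
    rintro a ⟨hd, ha, b, hab, he, ht⟩
    have ih' := ih b ht
    have hdef : O.addP p (de :: t) = O.addF p de (O.addP p t) := rfl
    rw [hdef]
    generalize O.addP p t = acc at ih'
    have hs0 : look [O.hd p] de.1 = SignType.sign (O.ev z (O.hd p)) := by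
      rw [hd, O.look_colOf _ _ _ _ h.hd, sg_hd]
    have ha' : a = -R ∨ O.IsRt z (p :: G) a := ha.imp id (IsRt.cons p)
    unfold addF
    rw [hs0]
    by_cases h0 : O.ev z (O.hd p) = 0
    · rw [if_pos (by simp [h0])]
      have hsg : ∀ y, O.sg z p y = O.sg z p.tail y := fun y => by
        simp only [sg]; rw [O.evU_tail z y p h0]
      refine ⟨?_, ha', b, hab, ?_, ih'⟩
      · simp only
        rw [hd, O.look_colOf _ _ _ _ h.tail, ← hsg, colOf_cons]
      · intro y h1 h2
        simp only
        rw [he y h1 h2, O.look_colOf _ _ _ _ h.tail, ← hsg, colOf_cons]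
    · rw [if_neg (by simpa using h0)]
      have hL : O.ptSign p de.1 = O.sg z p a := by
        rw [hd]; exact O.ptSign_correct z R hR p G h h0 a ha
      have hN : nextSign (SignType.sign (O.ev z (O.hd p))) acc = O.sg z p b := by
        cases acc with
        | nil =>
          have hb : b = R := ih'
          have h1 : SignType.sign (O.evU z b p) = _ :=
            h.large h0 b (by rw [abs_of_nonneg] <;> linarith)
          have h2 : 0 < b ^ (p.length - 1) := pow_pos (by linarith) _
          rw [sign_mul, sign_pos h2, mul_one] at h1
          exact h1.symm
        | cons de' t' =>
          have h1 : de'.1 = O.colOf z (p :: G) b := ih'.1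
          simp [nextSign, h1, colOf_cons]
      rw [hL, hN]
      have hinj := O.injOn z p h.len h0 hab (look (O.der p) de.2) (by
        intro y h1 h2
        rw [he y h1 h2, O.look_colOf _ _ _ _ h.der, sg])
      have hcase := inj_case hab (O.continuous_evU z p).continuousOn hinj
      unfold ref
      split_ifs with hs hs2
      · obtain ⟨x, hax, hxb, hx0, hl, hr⟩ := hcase.1 hs
        refine ⟨?_, ha', x, hax, ?_, ?_, Or.inr ⟨p, by simp, h.len, h0, hx0⟩, b, hxb, ?_, ih'⟩
        · simp only; rw [hd, colOf_cons]
        · intro y h1 h2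
          simp only; rw [he y h1 (h2.trans hxb), colOf_cons, sg, sg, hl y h1 h2]
        · simp only; rw [he x hax hxb, colOf_cons, sg, hx0, sign_zero]
        · intro y h1 h2
          simp only; rw [he y (hax.trans h1) h2, colOf_cons, sg, sg, hr y h1 h2]
      · have hm := hcase.2 hs
        refine ⟨?_, ha', b, hab, ?_, ih'⟩
        · simp only; rw [hd, colOf_cons]
        · intro y h1 h2
          have := hm y h1 h2
          simp only [sg] at hs2
          rw [if_pos hs2] at this
          simp only; rw [he y h1 h2, colOf_cons, sg, sg, this]
      · have hm := hcase.2 hs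
        refine ⟨?_, ha', b, hab, ?_, ih'⟩
        · simp only; rw [hd, colOf_cons]
        · intro y h1 h2
          have := hm y h1 h2
          simp only [sg] at hs2
          rw [if_neg hs2] at this
          simp only; rw [he y h1 h2, colOf_cons, sg, sg, this]

theorem diag_cover (z : Z) (R : ℝ) (G : List (List C)) (D : List (Col C × Col C)) :
    ∀ a, O.Diag z R G a D → ∀ y, a ≤ y → y < R → ∃ de ∈ D, de.1 = O.colOf z G y ∨ de.2 = O.colOf z G y := by
  induction D with
  | nil =>
    intro a ha y h1 h2
    have : a = R := ha
    linarith
  | cons de t ih =>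
    rintro a ⟨hd, _, b, hab, he, ht⟩ y h1 h2
    rcases eq_or_lt_of_le h1 with rfl | h1
    · exact ⟨de, by simp, Or.inl hd⟩
    · by_cases hyb : y < b
      · exact ⟨de, by simp, Or.inr (he y h1 hyb)⟩
      · obtain ⟨de', h, h'⟩ := ih b ht y (not_lt.1 hyb) h2
        exact ⟨de', List.mem_cons_of_mem _ h, h'⟩

theorem diag_col (z : Z) (R : ℝ) (G : List (List C)) (D : List (Col C × Col C)) :
    ∀ a, O.Diag z R G a D → ∀ de ∈ D, (∃ y, de.1 = O.colOf z G y) ∧ ∃ y, de.2 = O.colOf z G y := by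
  induction D with
  | nil => intro a _ de h; simp at h
  | cons de t ih =>
    rintro a ⟨hd, _, b, hab, he, ht⟩ de' h
    rcases List.mem_cons.1 h with rfl | h
    · exact ⟨⟨a, hd⟩, ⟨(a + b) / 2, he _ (by linarith) (by linarith)⟩⟩
    · exact ih b ht de' h

end Ops

end TS

namespace TS

namespace Ops

variable {C Z : Type} [Primcodable C] (O : Ops C Z)

noncomputable def lvl (K : List (List C)) (d : ℕ) (D : List (Col C × Col C)) : List (Col C × Col C) :=
  (K.filter fun p => p.length = d + 2).foldl (fun D p => O.addP p D) D

noncomputable def procD (K : List (List C)) (c0 : Col C) : List (Col C × Col C) :=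
  Nat.rec [(c0, c0)] (fun d D => O.lvl K d D) K.flatten.length

theorem p_procD : Primrec₂ O.procD := by
  refine Primrec.nat_rec' (f := fun x : List (List C) × Col C => x.1.flatten.length)
    (g := fun x => [(x.2, x.2)]) (h := fun x y => O.lvl x.1 y.1 y.2) ?_ ?_ ?_
  · exact Primrec.list_length.comp (Primrec.list_flatten.comp Primrec.fst)
  · exact Primrec.list_cons.comp (Primrec.snd.pair Primrec.snd) (Primrec.const [])
  · let A := (List (List C) × Col C) × (ℕ × List (Col C × Col C))
    refine Primrec.list_foldl (f := fun x : A => x.1.1.filter fun p => p.length = x.2.1 + 2)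
      (g := fun x : A => x.2.2) (h := fun _ y => O.addP y.2 y.1) ?_ ?_ ?_
    · have hr : PrimrecRel fun (p : List C) (d : ℕ) => p.length = d + 2 :=
        Primrec.eq.comp (Primrec.list_length.comp Primrec.fst)
          (Primrec.nat_add.comp Primrec.snd (Primrec.const 2))
      exact hr.listFilter.comp (Primrec.fst.comp Primrec.fst) (Primrec.fst.comp Primrec.snd)
    · exact Primrec.snd.comp Primrec.snd
    · exact O.p_addP.comp (Primrec.snd.comp Primrec.snd) (Primrec.fst.comp Primrec.snd)

/-- closed family with a good radius -/
structure Closed (z : Z) (R : ℝ) (K : List (List C)) : Prop where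
  cl : O.ops K ⊆ K
  two : 2 ≤ R
  large : ∀ p ∈ K, O.ev z (O.hd p) ≠ 0 → ∀ y : ℝ, R - 1 ≤ |y| →
    SignType.sign (O.evU z y p) = SignType.sign (O.ev z (O.hd p) * y ^ (p.length - 1))

variable {O}

theorem Closed.addOK {z : Z} {R : ℝ} {K : List (List C)} (h : O.Closed z R K) (d : ℕ)
    (p : List C) (hp : p ∈ K) (hl : p.length = d + 2) (G : List (List C))
    (h1 : ∀ q ∈ K, q.length ≤ d + 1 → q ∈ G) (h2 : ∀ q ∈ G, q ∈ K ∧ q.length ≤ d + 2) :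
    O.AddOK z R p G := by
  have hp2 : 2 ≤ p.length := by omega
  refine ⟨hp2, ?_, ?_, ?_, ?_, ?_, h.large p hp⟩
  · exact h1 _ (h.cl (O.mem_ops.2 ⟨p, hp, hp2, by simp⟩)) (by simp; omega)
  · exact h1 _ (h.cl (O.mem_ops.2 ⟨p, hp, hp2, by simp⟩)) (by rw [O.len_der]; omega)
  · exact h1 _ (h.cl (O.mem_ops.2 ⟨p, hp, hp2, by simp⟩)) (by simp)
  · intro q hq hq2
    exact h1 _ (h.cl (O.mem_ops.2 ⟨q, (h2 q hq).1, hq2, by simp⟩)) (by simp)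
  · intro q hq hq2
    have hq' := h2 q hq
    refine h1 _ (h.cl (O.mem_ops.2 ⟨p, hp, hp2, Or.inr (Or.inr (Or.inr
      ⟨q, hq'.1, hq2, by omega, rfl⟩))⟩)) ?_
    rw [O.len_prem p q (by omega) (by omega)]; omega

theorem Closed.fold {z : Z} {R : ℝ} {K : List (List C)} (h : O.Closed z R K) (d : ℕ)
    (Ps : List (List C)) : (∀ p ∈ Ps, p ∈ K ∧ p.length = d + 2) →
    ∀ (G : List (List C)) (D : List (Col C × Col C)), (∀ q ∈ K, q.length ≤ d + 1 → q ∈ G) →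
    (∀ q ∈ G, q ∈ K ∧ q.length ≤ d + 2) → O.Diag z R G (-R) D →
    ∃ G', O.Diag z R G' (-R) (Ps.foldl (fun D p => O.addP p D) D) ∧ G ⊆ G' ∧ Ps ⊆ G' ∧
      ∀ q ∈ G', q ∈ K ∧ q.length ≤ d + 2 := by
  induction Ps with
  | nil => intro _ G D h1 h2 hD; exact ⟨G, hD, fun _ h => h, by simp, h2⟩
  | cons p Ps ih =>
    intro hPs G D h1 h2 hD
    have hp := hPs p (by simp)
    have hok := h.addOK d p hp.1 hp.2 G h1 h2
    obtain ⟨G', a, b, c, e⟩ := ih (fun q hq => hPs q (List.mem_cons_of_mem _ hq)) (p :: G) (O.addP p D)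
      (fun q hq hl => List.mem_cons_of_mem _ (h1 q hq hl))
      (by
        intro q hq
        rcases List.mem_cons.1 hq with rfl | hq
        · exact ⟨hp.1, hp.2.le⟩
        · exact h2 q hq)
      (O.diag_add z R h.two p G hok D _ hD)
    refine ⟨G', a, fun q hq => b (List.mem_cons_of_mem _ hq), ?_, e⟩
    intro q hq
    rcases List.mem_cons.1 hq with rfl | hq
    · exact b (by simp)
    · exact c hq

def low (K : List (List C)) : List (List C) := K.filter fun p => p.length ≤ 1

theorem colOf_low (z : Z) (K : List (List C)) (y y' : ℝ) :
    O.colOf z (low K) y = O.colOf z (low K) y' := by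
  refine List.map_congr_left fun p hp => ?_
  have : p.length ≤ 1 := by simpa using (List.mem_filter.1 hp).2
  simp only [sg, O.evU_short z _ p this]

theorem Closed.procD {z : Z} {R : ℝ} {K : List (List C)} (h : O.Closed z R K) :
    ∃ G, K ⊆ G ∧ O.Diag z R G (-R) (O.procD K (O.colOf z (low K) 0)) := by
  have key : ∀ d : ℕ, ∃ G, (∀ q ∈ K, q.length ≤ d + 1 → q ∈ G) ∧
      (∀ q ∈ G, q ∈ K ∧ q.length ≤ d + 1) ∧
      O.Diag z R G (-R) (Nat.rec [(O.colOf z (low K) 0, O.colOf z (low K) 0)]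
        (fun d D => O.lvl K d D) d : List (Col C × Col C)) := by
    intro d
    induction d with
    | zero =>
      refine ⟨low K, ?_, ?_, ?_⟩
      · intro q hq hl; exact List.mem_filter.2 ⟨hq, by simpa using hl⟩
      · intro q hq; have := List.mem_filter.1 hq; exact ⟨this.1, by simpa using this.2⟩
      · refine ⟨colOf_low z K _ _, Or.inl rfl, R, by linarith [h.two], ?_, rfl⟩
        intro y _ _; exact colOf_low z K _ _
    | succ d ih =>
      obtain ⟨G, h1, h2, hD⟩ := ih
      obtain ⟨G', a, b, c, e⟩ := h.fold d (K.filter fun p => p.length = d + 2)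
        (by intro p hp; have := List.mem_filter.1 hp; exact ⟨this.1, by simpa using this.2⟩)
        G _ h1 (fun q hq => ⟨(h2 q hq).1, by have := (h2 q hq).2; omega⟩) hD
      refine ⟨G', ?_, e, a⟩
      intro q hq hl
      by_cases h' : q.length ≤ d + 1
      · exact b (h1 q hq h')
      · exact c (List.mem_filter.2 ⟨hq, by simp; omega⟩)
  obtain ⟨G, h1, _, hD⟩ := key K.flatten.length
  exact ⟨G, fun q hq => h1 q hq (by have := len_le_flatten K q hq; omega), hD⟩

theorem Closed.clamp {z : Z} {R : ℝ} {K : List (List C)} (h : O.Closed z R K) (y y' : ℝ)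
    (hyy : (R - 1 ≤ y ∧ R - 1 ≤ y') ∨ (y ≤ -(R-1) ∧ y' ≤ -(R-1))) (n : ℕ) :
    ∀ p ∈ K, p.length ≤ n → O.sg z p y = O.sg z p y' := by
  have hR := h.two
  induction n with
  | zero =>
    intro p hp hl
    simp only [sg, O.evU_short z _ p (by omega)]
  | succ n ih =>
    intro p hp hl
    by_cases h1 : p.length ≤ 1
    · simp only [sg, O.evU_short z _ p h1]
    by_cases h0 : O.ev z (O.hd p) = 0
    · have := ih p.tail (h.cl (O.mem_ops.2 ⟨p, hp, by omega, by simp⟩)) (by simp; omega)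
      simpa only [sg, O.evU_tail z _ p h0] using this
    · have hs : SignType.sign y = SignType.sign y' := by
        rcases hyy with ⟨a, b⟩ | ⟨a, b⟩
        · rw [sign_pos (by linarith), sign_pos (by linarith)]
        · rw [sign_neg (by linarith), sign_neg (by linarith)]
      have hy : R - 1 ≤ |y| := by rcases hyy with ⟨a, b⟩ | ⟨a, b⟩ <;> rw [le_abs] <;> [left; right] <;> linarith
      have hy' : R - 1 ≤ |y'| := by rcases hyy with ⟨a, b⟩ | ⟨a, b⟩ <;> rw [le_abs] <;> [left; right] <;> linarith
      simp only [sg]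
      rw [h.large p hp h0 y hy, h.large p hp h0 y' hy', sign_mul, sign_mul, sign_pow, sign_pow, hs]

theorem Closed.cover {z : Z} {R : ℝ} {K : List (List C)} (h : O.Closed z R K) (y : ℝ) :
    ∃ de ∈ O.procD K (O.colOf z (low K) 0),
      (∀ p ∈ K, look p de.1 = O.sg z p y) ∨ (∀ p ∈ K, look p de.2 = O.sg z p y) := by
  have hR := h.two
  have hcl : ∃ y', -R ≤ y' ∧ y' < R ∧ ∀ p ∈ K, O.sg z p y' = O.sg z p y := by
    by_cases h1 : R - 1 ≤ y
    · exact ⟨R - 1, by linarith, by linarith, fun p hp => h.clamp _ _ (Or.inl ⟨le_rfl, h1⟩) _ p hp le_rfl⟩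
    by_cases h2 : y ≤ -(R-1)
    · exact ⟨-(R - 1), by linarith, by linarith, fun p hp => h.clamp _ _ (Or.inr ⟨le_rfl, h2⟩) _ p hp le_rfl⟩
    · exact ⟨y, by linarith, by linarith, fun _ _ => rfl⟩
  obtain ⟨y', h1, h2, h3⟩ := hcl
  obtain ⟨G, hG, hD⟩ := h.procD
  obtain ⟨de, hde, h4⟩ := O.diag_cover z R G _ _ hD y' h1 h2
  refine ⟨de, hde, ?_⟩
  rcases h4 with h4 | h4
  · left; intro p hp; rw [h4, O.look_colOf z G _ p (hG hp), h3 p hp]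
  · right; intro p hp; rw [h4, O.look_colOf z G _ p (hG hp), h3 p hp]

theorem Closed.sound {z : Z} {R : ℝ} {K : List (List C)} (h : O.Closed z R K)
    (de : Col C × Col C) (hde : de ∈ O.procD K (O.colOf z (low K) 0)) :
    (∃ y, ∀ p ∈ K, look p de.1 = O.sg z p y) ∧ (∃ y, ∀ p ∈ K, look p de.2 = O.sg z p y) := by
  obtain ⟨G, hG, hD⟩ := h.procD
  obtain ⟨⟨y, h1⟩, ⟨y', h2⟩⟩ := O.diag_col z R G _ _ hD de hde
  exact ⟨⟨y, fun p hp => by rw [h1, O.look_colOf z G _ p (hG hp)]⟩,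
    ⟨y', fun p hp => by rw [h2, O.look_colOf z G _ p (hG hp)]⟩⟩

def assigns (G : List (List C)) : List (Col C) :=
  G.foldr (fun p acc => acc.flatMap fun c => [(p, 0) :: c, (p, 1) :: c, (p, -1) :: c]) [[]]

theorem p_assigns : Primrec (assigns : List (List C) → List (Col C)) := by
  refine Primrec.list_foldr (f := fun x : List (List C) => x) (g := fun _ => [[]])
    (h := fun _ (y : List C × List (Col C)) => y.2.flatMap fun c =>
      [(y.1, (0 : SignType)) :: c, (y.1, 1) :: c, (y.1, -1) :: c]) Primrec.id (Primrec.const _) ?_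
  refine Primrec.list_flatMap (Primrec.snd.comp Primrec.snd) ?_
  let A := (List (List C) × List C × List (Col C)) × Col C
  have hc : ∀ s : SignType, Primrec fun x : A => (x.1.2.1, s) :: x.2 := fun s =>
    Primrec.list_cons.comp ((Primrec.fst.comp (Primrec.snd.comp Primrec.fst)).pair
      (Primrec.const s)) Primrec.snd
  exact Primrec.list_cons.comp (hc 0) (Primrec.list_cons.comp (hc 1) (Primrec.list_cons.comp (hc (-1))
    (Primrec.const [])))

theorem mem_assigns (G : List (List C)) (c : Col C) : c ∈ assigns G ↔ c.map Prod.fst = G := by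
  induction G generalizing c with
  | nil => simp [assigns]
  | cons p G ih =>
    have : assigns (p :: G) = (assigns G).flatMap fun c =>
      [(p, 0) :: c, (p, 1) :: c, (p, -1) :: c] := rfl
    rw [this, List.mem_flatMap]
    constructor
    · rintro ⟨c', hc', h⟩
      have := (ih c').1 hc'
      simp only [List.mem_cons, List.not_mem_nil, or_false] at h
      rcases h with rfl | rfl | rfl <;> simp [this]
    · intro h
      cases c with
      | nil => simp at h
      | cons qs c =>
        obtain ⟨q, s⟩ := qs
        simp only [List.map_cons, List.cons.injEq] at h
        obtain ⟨rfl, h⟩ := h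
        refine ⟨c, (ih c).2 h, ?_⟩
        cases s <;> simp [SignType.zero_eq_zero, SignType.pos_eq_one, SignType.neg_eq_neg_one]

def good (S : Col C) (c : Col C) : Prop := ∀ ps ∈ S, look ps.1 c = ps.2

theorem p_good : PrimrecRel (good : Col C → Col C → Prop) := by
  have h : PrimrecRel fun (ps : List C × SignType) (c : Col C) => look ps.1 c = ps.2 :=
    Primrec.eq.comp (p_look.comp (Primrec.fst.comp Primrec.fst) Primrec.snd)
      (Primrec.snd.comp Primrec.fst)
  exact h.forall_mem_list

variable (O)

def KK (S : Col C) : List (List C) := O.clo (S.map Prod.fst)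

theorem p_KK : Primrec O.KK :=
  O.p_clo.comp (Primrec.list_map Primrec.id (Primrec.fst.comp Primrec.snd))

def okc (S c0 : Col C) : Prop := ∃ de ∈ O.procD (O.KK S) c0, good S de.1 ∨ good S de.2

theorem p_okc : PrimrecRel O.okc := by
  have h : PrimrecRel fun (de : Col C × Col C) (S : Col C) => good S de.1 ∨ good S de.2 :=
    PrimrecPred.or (p_good.comp Primrec.snd (Primrec.fst.comp Primrec.fst))
      (p_good.comp Primrec.snd (Primrec.snd.comp Primrec.fst))
  exact h.exists_mem_list.comp (O.p_procD.comp (O.p_KK.comp Primrec.fst) Primrec.snd) Primrec.fst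

open Classical in
noncomputable def out (S : Col C) : List (List (C × SignType)) :=
  (assigns (low (O.KK S))).filterMap fun c0 =>
    if O.okc S c0 then some (c0.map fun ps => (O.hd ps.1, ps.2)) else none

theorem p_out : Primrec O.out := by
  classical
  refine Primrec.listFilterMap (p_assigns.comp ?_) ?_
  · have h : PrimrecPred fun p : List C => p.length ≤ 1 :=
      Primrec.nat_le.comp Primrec.list_length (Primrec.const 1)
    exact (Primrec.listFilter h).comp O.p_KK
  · refine Primrec.ite O.p_okc (Primrec.option_some.comp (Primrec.list_map Primrec.snd ?_)) (Primrec.const none)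
    exact (O.p_hd.comp (Primrec.fst.comp Primrec.snd)).pair (Primrec.snd.comp Primrec.snd)

theorem out_iff (S : Col C) : (∃ T ∈ O.out S, ∃ z, ∀ cs ∈ T, SignType.sign (O.ev z cs.1) = cs.2) ↔
    ∃ z y, ∀ ps ∈ S, SignType.sign (O.evU z y ps.1) = ps.2 := by
  have hcl : ∀ z, ∃ R, O.Closed z R (O.KK S) := fun z => by
    obtain ⟨R, h1, h2⟩ := O.exists_R z (O.KK S)
    exact ⟨R, O.ops_clo _, h1, h2⟩
  have hS : ∀ ps ∈ S, ps.1 ∈ O.KK S := fun ps h =>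
    O.subset_clo _ (List.mem_map_of_mem h)
  constructor
  · rintro ⟨T, hT, z, hz⟩
    obtain ⟨c0, hc0, h⟩ := List.mem_filterMap.1 hT
    split_ifs at h with hok
    cases h
    obtain ⟨R, hR⟩ := hcl z
    have hc : c0 = O.colOf z (low (O.KK S)) 0 := by
      rw [← (mem_assigns _ _).1 hc0, colOf, List.map_map]
      conv_lhs => rw [← List.map_id c0]
      refine List.map_congr_left fun ps hps => ?_
      have hm : ps.1 ∈ low (O.KK S) := by
        rw [← (mem_assigns _ _).1 hc0]; exact List.mem_map_of_mem hps
      have hl : ps.1.length ≤ 1 := by simpa using (List.mem_filter.1 hm).2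
      have := hz (O.hd ps.1, ps.2) (List.mem_map.2 ⟨ps, hps, rfl⟩)
      simp only [Function.comp, sg, O.evU_short z _ _ hl]
      exact Prod.ext rfl this.symm
    obtain ⟨de, hde, hg⟩ := hok
    rw [hc] at hde
    obtain ⟨⟨y1, h1⟩, ⟨y2, h2⟩⟩ := hR.sound de hde
    rcases hg with hg | hg
    · exact ⟨z, y1, fun ps hps => (h1 _ (hS ps hps)).symm.trans (hg ps hps)⟩
    · exact ⟨z, y2, fun ps hps => (h2 _ (hS ps hps)).symm.trans (hg ps hps)⟩
  · rintro ⟨z, y, h⟩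
    obtain ⟨R, hR⟩ := hcl z
    obtain ⟨de, hde, hg⟩ := hR.cover y
    refine ⟨_, List.mem_filterMap.2 ⟨O.colOf z (low (O.KK S)) 0, (mem_assigns _ _).2 ?_, if_pos ?_⟩, z, ?_⟩
    · simp [colOf, Function.comp_def]
    · refine ⟨de, hde, ?_⟩
      rcases hg with hg | hg
      · exact Or.inl fun ps hps => (hg _ (hS ps hps)).trans (h ps hps)
      · exact Or.inr fun ps hps => (hg _ (hS ps hps)).trans (h ps hps)
    · intro cs hcs
      obtain ⟨ps, hps, rfl⟩ := List.mem_map.1 hcs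
      obtain ⟨p, hp, rfl⟩ := List.mem_map.1 hps
      have hl : p.length ≤ 1 := by simpa using (List.mem_filter.1 hp).2
      simp only [sg, O.evU_short z _ _ hl]

end Ops

end TS

namespace TS

namespace Ops

variable {C Z : Type} [Primcodable C] (O : Ops C Z)

theorem evU_append (z : Z) (y : ℝ) (p q : List C) :
    O.evU z y (p ++ q) = O.evU z y p * y ^ q.length + O.evU z y q := by
  induction p with
  | nil => simp [evU]
  | cons a p ih =>
    simp only [List.cons_append, evU, ih, List.length_append, pow_add]; ring

theorem evU_map (z : Z) (y : ℝ) (f : C → C) (r : ℝ) (h : ∀ a, O.ev z (f a) = r * O.ev z a)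
    (p : List C) : O.evU z y (p.map f) = r * O.evU z y p := by
  induction p with
  | nil => simp [evU]
  | cons a p ih => simp only [List.map_cons, evU, ih, List.length_map, h]; ring

def pad (k : ℕ) (p : List C) : List C := ((List.range (k - p.length)).map fun _ => O.zero) ++ p

theorem p_pad : Primrec₂ O.pad := by
  refine Primrec.list_append.comp (Primrec.list_map (Primrec.list_range.comp ?_) (Primrec.const _)) Primrec.snd
  exact Primrec.nat_sub.comp Primrec.fst (Primrec.list_length.comp Primrec.snd)

theorem len_pad (k : ℕ) (p : List C) : (O.pad k p).length = max k p.length := by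
  simp [pad]; omega

theorem ev_pad (z : Z) (y : ℝ) (k : ℕ) (p : List C) : O.evU z y (O.pad k p) = O.evU z y p := by
  have : ∀ l : List ℕ, O.evU z y (l.map fun _ => O.zero) = 0 := by
    intro l
    induction l with
    | nil => rfl
    | cons a l ih => simp only [List.map_cons, evU, ih, O.ev_zero]; ring
  rw [pad, evU_append, this]; ring

def ladd (p q : List C) : List C := O.lin O.one O.one (O.pad q.length p) (O.pad p.length q)

theorem ev_ladd (z : Z) (y : ℝ) (p q : List C) :
    O.evU z y (O.ladd p q) = O.evU z y p + O.evU z y q := by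
  rw [ladd, O.ev_lin _ _ _ _ _ _ (by rw [len_pad, len_pad]; omega), len_pad, len_pad, ev_pad, ev_pad,
    O.ev_one, max_comm, Nat.sub_self]
  ring

theorem p_ladd : Primrec₂ O.ladd :=
  O.p_lin (Primrec.const _) (Primrec.const _)
    (O.p_pad.comp (Primrec.list_length.comp Primrec.snd) Primrec.fst)
    (O.p_pad.comp (Primrec.list_length.comp Primrec.fst) Primrec.snd)

def lmul (p q : List C) : List C :=
  p.foldl (fun acc a => O.ladd (acc ++ [O.zero]) (q.map fun b => O.mul a b)) []

theorem p_lmul : Primrec₂ O.lmul := by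
  refine Primrec.list_foldl (f := fun x : List C × List C => x.1) (g := fun _ => [])
    (h := fun x (y : List C × C) => O.ladd (y.1 ++ [O.zero]) (x.2.map fun b => O.mul y.2 b))
    Primrec.fst (Primrec.const _) ?_
  refine O.p_ladd.comp (Primrec.list_append.comp (Primrec.fst.comp Primrec.snd) (Primrec.const _))
    (Primrec.list_map (Primrec.snd.comp Primrec.fst) ?_)
  exact O.p_mul.comp (Primrec.snd.comp (Primrec.snd.comp Primrec.fst)) Primrec.snd

theorem ev_lmul (z : Z) (y : ℝ) (p q : List C) :
    O.evU z y (O.lmul p q) = O.evU z y p * O.evU z y q := by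
  have : ∀ acc, O.evU z y (p.foldl (fun acc a => O.ladd (acc ++ [O.zero]) (q.map fun b => O.mul a b)) acc)
      = O.evU z y acc * y ^ p.length + O.evU z y p * O.evU z y q := by
    induction p with
    | nil => intro acc; simp [evU]
    | cons a p ih =>
      intro acc
      rw [List.foldl_cons, ih, ev_ladd, evU_append,
        O.evU_map z y (fun b => O.mul a b) (O.ev z a) (fun b => O.ev_mul z a b)]
      simp only [evU, O.ev_zero, List.length_cons, List.length_nil, pow_succ]
      ring
  rw [lmul, this]; simp [evU]

/-- polynomials over `O` in one more variable -/
def lops {Z' : Type} (π : Z' → Z) (η : Z' → ℝ) : Ops (List C) Z' where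
  zero := []
  one := [O.one]
  add := O.ladd
  mul := O.lmul
  neg p := p.map O.neg
  ev z p := O.evU (π z) (η z) p
  p_add := O.p_ladd
  p_mul := O.p_lmul
  p_neg := Primrec.list_map Primrec.id (O.p_neg.comp Primrec.snd)
  ev_zero _ := rfl
  ev_one z := by simp [evU, O.ev_one]
  ev_add z a b := O.ev_ladd _ _ a b
  ev_mul z a b := O.ev_lmul _ _ a b
  ev_neg z a := by
    rw [O.evU_map _ _ O.neg (-1) (fun b => by rw [O.ev_neg]; ring)]; ring

end Ops

/-- A computable presentation of polynomials in `n` variables with decidable sign systems. -/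
structure Rep (n : ℕ) where
  C : Type
  [pc : Primcodable C]
  O : Ops C (Fin n → ℝ)
  const : C0 → C
  p_const : Primrec const
  ev_const : ∀ z c, O.ev z (const c) = c.ev
  var : Fin n → C
  ev_var : ∀ z i, O.ev z (var i) = z i
  dec : PrimrecPred fun S : List (C × SignType) => ∃ z, ∀ cs ∈ S, SignType.sign (O.ev z cs.1) = cs.2

attribute [instance] Rep.pc

def Rep.succ {n : ℕ} (r : Rep n) : Rep (n + 1) where
  C := List r.C
  O := r.O.lops (fun z i => z i.succ) (fun z => z 0)
  const c := [r.const c]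
  p_const := Primrec.list_cons.comp r.p_const (Primrec.const [])
  ev_const z c := by simp [Ops.lops, Ops.evU, r.ev_const]
  var := Fin.cons [r.O.one, r.O.zero] fun i => [r.var i]
  ev_var z i := by
    refine Fin.cases ?_ (fun i => ?_) i
    · simp [Ops.lops, Ops.evU, r.O.ev_one, r.O.ev_zero]
    · simp [Ops.lops, Ops.evU, r.ev_var]
  dec := by
    refine (r.dec.exists_mem_list.comp r.O.p_out).of_eq fun S => ?_
    rw [r.O.out_iff S]
    constructor
    · rintro ⟨z, y, h⟩
      exact ⟨Fin.cons y z, fun cs hcs => by simpa [Ops.lops] using h cs hcs⟩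
    · rintro ⟨z, h⟩
      exact ⟨fun i => z i.succ, z 0, h⟩

def addC (x y : C0) : C0 :=
  (x.1 * (y.2.2 + 1) + y.1 * (x.2.2 + 1), x.2.1 * (y.2.2 + 1) + y.2.1 * (x.2.2 + 1),
    x.2.2 * y.2.2 + x.2.2 + y.2.2)

def mulC (x y : C0) : C0 :=
  (x.1 * y.1 + x.2.1 * y.2.1, x.1 * y.2.1 + x.2.1 * y.1, x.2.2 * y.2.2 + x.2.2 + y.2.2)

def signC (x : C0) : SignType := if x.1 < x.2.1 then -1 else if x.2.1 < x.1 then 1 else 0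

theorem signC_eq (x : C0) : SignType.sign x.ev = signC x := by
  obtain ⟨a, b, c⟩ := x
  have hc : (0 : ℝ) < c + 1 := by positivity
  simp only [signC, C0.ev]
  split_ifs with h1 h2
  · have : (a : ℝ) < b := by exact_mod_cast h1
    exact sign_neg (div_neg_of_neg_of_pos (by linarith) hc)
  · have : (b : ℝ) < a := by exact_mod_cast h2
    exact sign_pos (div_pos (by linarith) hc)
  · have : a = b := by omega
    simp [this]

noncomputable def ops0 : Ops C0 (Fin 0 → ℝ) where
  zero := (0, 0, 0)
  one := (1, 0, 0)
  add := addC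
  mul := mulC
  neg x := (x.2.1, x.1, x.2.2)
  ev _ c := c.ev
  p_add := by
    have a1 : Primrec fun x : C0 × C0 => x.1.1 := Primrec.fst.comp Primrec.fst
    have b1 : Primrec fun x : C0 × C0 => x.1.2.1 := Primrec.fst.comp (Primrec.snd.comp Primrec.fst)
    have c1 : Primrec fun x : C0 × C0 => x.1.2.2 := Primrec.snd.comp (Primrec.snd.comp Primrec.fst)
    have a2 : Primrec fun x : C0 × C0 => x.2.1 := Primrec.fst.comp Primrec.snd
    have b2 : Primrec fun x : C0 × C0 => x.2.2.1 := Primrec.fst.comp (Primrec.snd.comp Primrec.snd)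
    have c2 : Primrec fun x : C0 × C0 => x.2.2.2 := Primrec.snd.comp (Primrec.snd.comp Primrec.snd)
    have ad := fun {f g : C0 × C0 → ℕ} (hf : Primrec f) (hg : Primrec g) => Primrec.nat_add.comp hf hg
    have mu := fun {f g : C0 × C0 → ℕ} (hf : Primrec f) (hg : Primrec g) => Primrec.nat_mul.comp hf hg
    have s1 := Primrec.succ.comp c1
    have s2 := Primrec.succ.comp c2
    exact (ad (mu a1 s2) (mu a2 s1)).pair ((ad (mu b1 s2) (mu b2 s1)).pair (ad (ad (mu c1 c2) c1) c2))
  p_mul := by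
    have a1 : Primrec fun x : C0 × C0 => x.1.1 := Primrec.fst.comp Primrec.fst
    have b1 : Primrec fun x : C0 × C0 => x.1.2.1 := Primrec.fst.comp (Primrec.snd.comp Primrec.fst)
    have c1 : Primrec fun x : C0 × C0 => x.1.2.2 := Primrec.snd.comp (Primrec.snd.comp Primrec.fst)
    have a2 : Primrec fun x : C0 × C0 => x.2.1 := Primrec.fst.comp Primrec.snd
    have b2 : Primrec fun x : C0 × C0 => x.2.2.1 := Primrec.fst.comp (Primrec.snd.comp Primrec.snd)
    have c2 : Primrec fun x : C0 × C0 => x.2.2.2 := Primrec.snd.comp (Primrec.snd.comp Primrec.snd)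
    have ad := fun {f g : C0 × C0 → ℕ} (hf : Primrec f) (hg : Primrec g) => Primrec.nat_add.comp hf hg
    have mu := fun {f g : C0 × C0 → ℕ} (hf : Primrec f) (hg : Primrec g) => Primrec.nat_mul.comp hf hg
    exact (ad (mu a1 a2) (mu b1 b2)).pair ((ad (mu a1 b2) (mu b1 a2)).pair (ad (ad (mu c1 c2) c1) c2))
  p_neg := (Primrec.fst.comp Primrec.snd).pair (Primrec.fst.pair (Primrec.snd.comp Primrec.snd))
  ev_zero _ := by simp [C0.ev]
  ev_one _ := by simp [C0.ev]
  ev_add _ x y := by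
    obtain ⟨a, b, c⟩ := x
    obtain ⟨a', b', c'⟩ := y
    have hc : (c : ℝ) + 1 ≠ 0 := by positivity
    have hc' : (c' : ℝ) + 1 ≠ 0 := by positivity
    have e : ((c * c' + c + c' : ℕ) : ℝ) + 1 = (c + 1) * (c' + 1) := by push_cast; ring
    simp only [addC, C0.ev]
    rw [e]; push_cast; field_simp; ring
  ev_mul _ x y := by
    obtain ⟨a, b, c⟩ := x
    obtain ⟨a', b', c'⟩ := y
    have hc : (c : ℝ) + 1 ≠ 0 := by positivity
    have hc' : (c' : ℝ) + 1 ≠ 0 := by positivity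
    have e : ((c * c' + c + c' : ℕ) : ℝ) + 1 = (c + 1) * (c' + 1) := by push_cast; ring
    simp only [mulC, C0.ev]
    rw [e]; push_cast; field_simp; ring
  ev_neg _ x := by simp only [C0.ev]; ring

noncomputable def rep0 : Rep 0 where
  C := C0
  O := ops0
  const c := c
  p_const := Primrec.id
  ev_const _ _ := rfl
  var i := i.elim0
  ev_var _ i := i.elim0
  dec := by
    have hs : Primrec signC := by
      have a : Primrec fun x : C0 => x.1 := Primrec.fst
      have b : Primrec fun x : C0 => x.2.1 := Primrec.fst.comp Primrec.snd
      exact Primrec.ite (Primrec.nat_lt.comp a b) (Primrec.const _)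
        (Primrec.ite (Primrec.nat_lt.comp b a) (Primrec.const _) (Primrec.const _))
    have h : PrimrecPred fun cs : C0 × SignType => signC cs.1 = cs.2 :=
      Primrec.eq.comp (hs.comp Primrec.fst) Primrec.snd
    refine h.forall_mem_list.of_eq fun S => ?_
    constructor
    · intro h; exact ⟨fun i => i.elim0, fun cs hcs => (signC_eq cs.1).trans (h cs hcs)⟩
    · rintro ⟨_, h⟩ cs hcs; exact (signC_eq cs.1).symm.trans (h cs hcs)

noncomputable def rep : (n : ℕ) → Rep n
  | 0 => rep0
  | n + 1 => (rep n).succ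

namespace Ops

variable {C Z : Type} [Primcodable C] (O : Ops C Z)

def pw (a : C) (k : ℕ) : C := Nat.rec O.one (fun _ x => O.mul x a) k

theorem p_pw : Primrec₂ O.pw :=
  Primrec.nat_rec (f := fun _ : C => O.one) (g := fun a (p : ℕ × C) => O.mul p.2 a)
    (Primrec.const _) (O.p_mul.comp (Primrec.snd.comp Primrec.snd) Primrec.fst)

theorem ev_pw (z : Z) (a : C) (k : ℕ) : O.ev z (O.pw a k) = O.ev z a ^ k := by
  induction k with
  | zero => simp [pw, O.ev_one]
  | succ k ih =>
    have : O.pw a (k + 1) = O.mul (O.pw a k) a := rfl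
    rw [this, O.ev_mul, ih, pow_succ]

end Ops

variable {n : ℕ} (r : Rep n)

def mono (l : List (Fin n)) (e : Fin n → ℕ) : r.C :=
  l.foldr (fun i acc => r.O.mul (r.O.pw (r.var i) (e i)) acc) r.O.one

theorem p_mono (l : List (Fin n)) : Primrec (mono r l) := by
  induction l with
  | nil => exact Primrec.const _
  | cons i l ih =>
    have h : Primrec fun e : Fin n → ℕ => e i := Primrec.fin_app.comp Primrec.id (Primrec.const i)
    exact r.O.p_mul.comp (r.O.p_pw.comp (Primrec.const _) h) ih

theorem ev_mono (l : List (Fin n)) (e : Fin n → ℕ) (z : Fin n → ℝ) :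
    r.O.ev z (mono r l e) = (l.map fun i => z i ^ e i).prod := by
  induction l with
  | nil => simp [mono, r.O.ev_one]
  | cons i l ih =>
    have : mono r (i :: l) e = r.O.mul (r.O.pw (r.var i) (e i)) (mono r l e) := rfl
    rw [this, r.O.ev_mul, ih, r.O.ev_pw, r.ev_var]; simp

def tr (L : List ((Fin n → ℕ) × ℚ)) : r.C :=
  L.foldr (fun ec acc => r.O.add (r.O.mul (r.const (conv ec.2)) (mono r (List.finRange n) ec.1)) acc)
    r.O.zero

theorem p_tr : Primrec (tr r) := by
  refine Primrec.list_foldr (f := fun x : List ((Fin n → ℕ) × ℚ) => x) (g := fun _ => r.O.zero)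
    (h := fun _ (y : ((Fin n → ℕ) × ℚ) × r.C) =>
      r.O.add (r.O.mul (r.const (conv y.1.2)) (mono r (List.finRange n) y.1.1)) y.2)
    Primrec.id (Primrec.const _) ?_
  have h1 : Primrec fun y : List ((Fin n → ℕ) × ℚ) × (((Fin n → ℕ) × ℚ) × r.C) => y.2.1 :=
    Primrec.fst.comp Primrec.snd
  exact r.O.p_add.comp (r.O.p_mul.comp (r.p_const.comp (primrec_conv.comp (Primrec.snd.comp h1)))
    ((p_mono r _).comp (Primrec.fst.comp h1))) (Primrec.snd.comp Primrec.snd)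

theorem ev_tr (L : List ((Fin n → ℕ) × ℚ)) (z : Fin n → ℝ) :
    r.O.ev z (tr r L) = encodedPolyEval n L z := by
  induction L with
  | nil => simp [tr, r.O.ev_zero, encodedPolyEval]
  | cons ec L ih =>
    have : tr r (ec :: L) = r.O.add (r.O.mul (r.const (conv ec.2)) (mono r (List.finRange n) ec.1))
      (tr r L) := rfl
    rw [this, r.O.ev_add, ih, r.O.ev_mul, r.ev_const, conv_ev, ev_mono]
    simp [encodedPolyEval, Fin.prod_univ_def]

end TS

/-- Tarski-Seidenberg: it is computable to decide whether a finite list of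
polynomial equalities and strict inequalities with rational coefficients in
`n` real variables has a common real solution. -/
theorem tarski_seidenberg_decidable (n : ℕ) :
    ComputablePred
      (fun PQ : List (List ((Fin n → ℕ) × ℚ)) × List (List ((Fin n → ℕ) × ℚ)) =>
        ∃ x : Fin n → ℝ,
          (∀ p ∈ PQ.1, encodedPolyEval n p x = 0) ∧
          (∀ q ∈ PQ.2, 0 < encodedPolyEval n q x)) := by
  let r := TS.rep n
  have hf : Primrec fun PQ : List (List ((Fin n → ℕ) × ℚ)) × List (List ((Fin n → ℕ) × ℚ)) =>
      (PQ.1.map fun p => (TS.tr r p, (0 : SignType))) ++ PQ.2.map fun p => (TS.tr r p, (1 : SignType)) := by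
    refine Primrec.list_append.comp (Primrec.list_map Primrec.fst ?_) (Primrec.list_map Primrec.snd ?_)
    · exact ((TS.p_tr r).comp Primrec.snd).pair (Primrec.const _)
    · exact ((TS.p_tr r).comp Primrec.snd).pair (Primrec.const _)
  have h := (r.dec.comp hf).of_eq (q := fun PQ : List (List ((Fin n → ℕ) × ℚ)) × List (List ((Fin n → ℕ) × ℚ)) =>
        ∃ x : Fin n → ℝ,
          (∀ p ∈ PQ.1, encodedPolyEval n p x = 0) ∧
          (∀ q ∈ PQ.2, 0 < encodedPolyEval n q x)) (by
    intro PQ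
    refine exists_congr fun x => ?_
    constructor
    · intro h
      refine ⟨fun p hp => ?_, fun q hq => ?_⟩
      · have := h (TS.tr r p, 0) (List.mem_append_left _ (List.mem_map.2 ⟨p, hp, rfl⟩))
        rw [TS.ev_tr] at this
        exact sign_eq_zero_iff.1 this
      · have := h (TS.tr r q, 1) (List.mem_append_right _ (List.mem_map.2 ⟨q, hq, rfl⟩))
        rw [TS.ev_tr] at this
        exact sign_eq_one_iff.1 this
    · rintro ⟨h1, h2⟩ cs hcs
      rcases List.mem_append.1 hcs with h | h
      · obtain ⟨p, hp, rfl⟩ := List.mem_map.1 h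
        rw [TS.ev_tr]
        exact sign_eq_zero_iff.2 (h1 p hp)
      · obtain ⟨p, hp, rfl⟩ := List.mem_map.1 h
        rw [TS.ev_tr]
        exact sign_eq_one_iff.2 (h2 p hp))
  obtain ⟨hd, hp⟩ := h
  exact ⟨hd, hp.to_comp⟩
end
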